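/- arXiv:2409.17762 — 4 statements merged into one kernel-verified Lean document; each statement's English description precedes it below -/
import Mathlib

section
/- If f ∈ 𝓑 with Taylor coefficients a_n, then for every 0 < r < 1: if |a₀| ≥ r then Σ_{n=1}^∞ |a_n| r^n ≤ r(1−|a₀|²)/(1−r|a₀|), and if |a₀| < r then Σ_{n=1}^∞ |a_n| r^n ≤ r·√(1−|a₀|²)/√(1−r²). -/
open Metric

open Filter Topology ComplexConjugate

theorem parseval_aux (c : ℕ → ℂ) (hc : Summable (fun n => ‖c n‖)) :
    ∃ x : MeasureTheory.Lp ℂ 2 (@AddCircle.haarAddCircle (1:ℝ) _),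
      HasSum (fun n => ‖c n‖ ^ 2) (‖x‖ ^ 2) ∧
      ∀ᵐ t ∂(@AddCircle.haarAddCircle (1:ℝ) _), x t = ∑' n, c n * (AddCircle.toCircle t : ℂ) ^ n := by
  have hs : Summable (fun n : ℕ => c n • (fourier (n : ℤ) : C(AddCircle (1:ℝ), ℂ))) := by
    apply Summable.of_norm
    simpa [norm_smul, fourier_norm] using hc
  obtain ⟨g, hg⟩ := hs
  refine ⟨ContinuousMap.toLp (E := ℂ) 2 AddCircle.haarAddCircle ℂ g, ?_, ?_⟩
  · have h1 := (ContinuousMap.toLp (E := ℂ) 2 (@AddCircle.haarAddCircle (1:ℝ) _) ℂ).hasSum hg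
    have h2 := (h1.norm).pow 2
    refine Tendsto.congr ?_ h2
    intro s
    have ho : Orthonormal ℂ (fun n : ℕ => @fourierLp (1:ℝ) _ 2 _ (n : ℤ)) :=
      orthonormal_fourier.comp (fun n : ℕ => (n : ℤ)) Nat.cast_injective
    have h3 := ho.inner_sum c c s
    have h4 := inner_self_eq_norm_sq_to_K (𝕜 := ℂ)
      (∑ i ∈ s, c i • (@fourierLp (1:ℝ) _ 2 _ (i : ℤ)))
    rw [h3] at h4
    simp only [Function.comp, map_smul]
    have h5 : ((∑ i ∈ s, ‖c i‖ ^ 2 : ℝ) : ℂ) = ((‖∑ i ∈ s, c i • (@fourierLp (1:ℝ) _ 2 _ (i : ℤ))‖ ^ 2 : ℝ) : ℂ) := by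
      push_cast
      rw [← Complex.coe_algebraMap] at *
      rw [← h4]
      apply Finset.sum_congr rfl
      intro i _
      rw [mul_comm, Complex.mul_conj, Complex.normSq_eq_norm_sq]
      push_cast
      rfl
    exact (Complex.ofReal_injective h5).symm
  · filter_upwards [ContinuousMap.coeFn_toLp (p := 2) (𝕜 := ℂ) (@AddCircle.haarAddCircle (1:ℝ) _) g] with t ht
    rw [ht]
    have := (ContinuousMap.evalCLM ℂ t).hasSum hg
    have h2 := this.tsum_eq
    simp only [ContinuousMap.evalCLM_apply] at h2
    rw [← h2]
    apply tsum_congr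
    intro n
    simp [Function.comp, AddCircle.toCircle_nsmul]

theorem parseval_le (c d : ℕ → ℂ) (hc : Summable (fun n => ‖c n‖)) (hd : Summable (fun n => ‖d n‖))
    (h : ∀ w : ℂ, ‖w‖ = 1 → ‖∑' n, c n * w ^ n‖ ≤ ‖∑' n, d n * w ^ n‖) :
    ∃ X Y : ℝ, HasSum (fun n => ‖c n‖ ^ 2) X ∧ HasSum (fun n => ‖d n‖ ^ 2) Y ∧ X ≤ Y := by
  obtain ⟨x, hx, hx'⟩ := parseval_aux c hc
  obtain ⟨y, hy, hy'⟩ := parseval_aux d hd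
  refine ⟨_, _, hx, hy, ?_⟩
  gcongr
  apply MeasureTheory.Lp.norm_le_norm_of_ae_le
  filter_upwards [hx', hy'] with t h1 h2
  rw [h1, h2]
  exact h _ (Circle.norm_coe _)

theorem mobius_ineq (u v : ℂ) (hu : ‖u‖ ≤ 1) (hv : ‖v‖ ≤ 1) : ‖u - v‖ ≤ ‖1 - conj v * u‖ := by
  apply le_of_sq_le_sq _ (norm_nonneg _)
  have h1 : 0 ≤ (1 - ‖u‖ ^ 2) * (1 - ‖v‖ ^ 2) := by
    apply mul_nonneg <;> nlinarith [norm_nonneg u, norm_nonneg v]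
  simp only [← Complex.normSq_eq_norm_sq, Complex.normSq_apply] at *
  simp at *
  nlinarith

theorem schwarz_pick_zero (f : ℂ → ℂ)
    (hd : DifferentiableOn ℂ f (ball (0 : ℂ) 1))
    (hb : ∀ z ∈ ball (0 : ℂ) 1, ‖f z‖ ≤ 1) (z : ℂ) (hz : z ∈ ball (0 : ℂ) 1) :
    ‖f z - f 0‖ ≤ ‖z‖ * ‖1 - conj (f 0) * f z‖ := by
  have h0 : (0 : ℂ) ∈ ball (0 : ℂ) 1 := by simp
  have key : ∀ t ∈ Set.Ioo (0:ℝ) 1,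
      ‖(t:ℂ) * f z - t * f 0‖ ≤ ‖z‖ * ‖1 - conj ((t:ℂ) * f 0) * (t * f z)‖ := by
    intro t ht
    have hlt : ∀ w ∈ ball (0 : ℂ) 1, ‖(t:ℂ) * f w‖ < 1 := by
      intro w hw
      rw [norm_mul, Complex.norm_real, Real.norm_of_nonneg ht.1.le]
      nlinarith [hb w hw, norm_nonneg (f w), ht.1, ht.2]
    have hne : ∀ w ∈ ball (0 : ℂ) 1, 1 - conj ((t:ℂ) * f 0) * (t * f w) ≠ 0 := by
      intro w hw h
      have h1 := congrArg norm (sub_eq_zero.mp h)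
      rw [norm_one, norm_mul, Complex.norm_conj] at h1
      nlinarith [hlt w hw, hlt 0 h0, norm_nonneg ((t:ℂ) * f w), norm_nonneg ((t:ℂ) * f 0)]
    have := Complex.norm_le_norm_of_mapsTo_ball (z := z) (R := 1)
      (f := fun w => ((t:ℂ) * f w - t * f 0) / (1 - conj ((t:ℂ) * f 0) * (t * f w)))
      (by
        apply DifferentiableOn.div
        · exact (hd.const_mul _).sub_const _
        · exact ((hd.const_mul _).const_mul _).const_sub _
        · exact hne)
      (by
        intro w hw
        rw [mem_closedBall_zero_iff, norm_div]
        exact div_le_one_of_le₀ (mobius_ineq _ _ (hlt w hw).le (hlt 0 h0).le) (norm_nonneg _))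
      (by simp) (by simpa using hz)
    rw [norm_div, div_le_iff₀ (norm_pos_iff.mpr (hne z hz))] at this
    exact this
  have hcl : (1:ℝ) ∈ closure (Set.Ioo (0:ℝ) 1) := by
    rw [closure_Ioo (by norm_num)]; simp
  have := ContinuousWithinAt.closure_le hcl
    (f := fun t : ℝ => ‖(t:ℂ) * f z - t * f 0‖)
    (g := fun t : ℝ => ‖z‖ * ‖1 - conj ((t:ℂ) * f 0) * (t * f z)‖)
    (Continuous.continuousWithinAt (by fun_prop))
    (Continuous.continuousWithinAt (by simp only [map_mul, Complex.conj_ofReal]; fun_prop)) key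
  simpa using this

theorem coeff_lt (f : ℂ → ℂ)
    (hd : DifferentiableOn ℂ f (ball (0 : ℂ) 1))
    (hb : ∀ z ∈ ball (0 : ℂ) 1, ‖f z‖ ≤ 1)
    (a : ℕ → ℂ)
    (ha : ∀ z ∈ ball (0 : ℂ) 1, HasSum (fun n : ℕ => a n * z ^ n) (f z))
    (N : ℕ) (s : ℝ) (hs : s ∈ Set.Ioo (0:ℝ) 1) (hf0 : f 0 = a 0) :
    (1 - s ^ 2 * ‖a 0‖ ^ 2) * ∑ n ∈ Finset.range N, ‖a (n + 1)‖ ^ 2 * (s ^ 2) ^ (n + 1) ≤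
      s ^ 2 * (1 - ‖a 0‖ ^ 2) ^ 2 := by
  have hmem : ∀ w : ℂ, ‖w‖ = 1 → (s : ℂ) * w ∈ ball (0 : ℂ) 1 := by
    intro w hw
    simp [hw, abs_of_pos hs.1, hs.2]
  have hA : ‖a 0‖ ≤ 1 := by rw [← hf0]; exact hb 0 (by simp)
  set c : ℕ → ℂ := fun n => a n * s ^ n - if n = 0 then a 0 else 0 with hcdef
  set d : ℕ → ℂ := fun n => s * ((if n = 0 then 1 else 0) - conj (a 0) * (a n * s ^ n)) with hddef
  have hcw : ∀ w : ℂ, ‖w‖ = 1 → HasSum (fun n => c n * w ^ n) (f (s * w) - a 0) := by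
    intro w hw
    have h1 := (ha _ (hmem w hw)).sub (hasSum_ite_eq (0:ℕ) (a 0))
    refine h1.congr_fun ?_
    intro n
    rcases eq_or_ne n 0 with rfl | hn
    · simp [hcdef]
    · simp [hcdef, hn]; ring
  have hdw : ∀ w : ℂ, ‖w‖ = 1 →
      HasSum (fun n => d n * w ^ n) (s * (1 - conj (a 0) * f (s * w))) := by
    intro w hw
    have h1 := ((hasSum_ite_eq (0:ℕ) (1:ℂ)).sub ((ha _ (hmem w hw)).mul_left (conj (a 0)))).mul_left (s:ℂ)
    refine h1.congr_fun ?_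
    intro n
    rcases eq_or_ne n 0 with rfl | hn
    · simp [hddef]
    · simp [hddef, hn]; ring
  have hcs : Summable (fun n => ‖c n‖) := by
    simpa using (hcw 1 (by simp)).summable.norm
  have hds : Summable (fun n => ‖d n‖) := by
    simpa using (hdw 1 (by simp)).summable.norm
  obtain ⟨X, Y, hX, hY, hXY⟩ := parseval_le c d hcs hds (by
    intro w hw
    rw [(hcw w hw).tsum_eq, (hdw w hw).tsum_eq, norm_mul]
    have := schwarz_pick_zero f hd hb _ (hmem w hw)
    rw [norm_mul, hw, mul_one, hf0] at this
    exact this)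
  have hY2 : HasSum (fun n => ‖d n‖ ^ 2) (s ^ 2 * ‖a 0‖ ^ 2 * X + s ^ 2 * (1 - ‖a 0‖ ^ 2) ^ 2) := by
    have h1 := (hX.mul_left (s ^ 2 * ‖a 0‖ ^ 2)).add (hasSum_ite_eq (0:ℕ) (s ^ 2 * (1 - ‖a 0‖ ^ 2) ^ 2))
    refine h1.congr_fun ?_
    intro n
    rcases eq_or_ne n 0 with rfl | hn
    · have : conj (a 0) * a 0 = ((‖a 0‖ ^ 2 : ℝ) : ℂ) := by
        rw [mul_comm, Complex.mul_conj, Complex.normSq_eq_norm_sq]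
      have hc0 : c 0 = 0 := by simp [hcdef]
      have hd0 : d 0 = ((s * (1 - ‖a 0‖ ^ 2) : ℝ) : ℂ) := by
        simp only [hddef, if_true, pow_zero, mul_one, this]
        push_cast
        rfl
      rw [hc0, hd0, Complex.norm_real, Real.norm_eq_abs, sq_abs]
      simp only [norm_zero, if_true]
      ring
    · simp [hcdef, hddef, hn, mul_pow]
      ring
  have hYe := hY.unique hY2
  have hP : ∑ n ∈ Finset.range N, ‖a (n + 1)‖ ^ 2 * (s ^ 2) ^ (n + 1) ≤ X := by
    have h1 := sum_le_hasSum (Finset.range (N + 1)) (fun i _ => sq_nonneg ‖c i‖) hX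
    rw [Finset.sum_range_succ'] at h1
    have h0 : c 0 = 0 := by simp [hcdef]
    rw [h0] at h1
    simp only [norm_zero, ne_eq, OfNat.ofNat_ne_zero, not_false_eq_true, zero_pow, add_zero] at h1
    refine le_trans (le_of_eq ?_) h1
    apply Finset.sum_congr rfl
    intro n _
    simp only [hcdef, Nat.succ_ne_zero, if_false, sub_zero, norm_mul, norm_pow, Complex.norm_real,
      Real.norm_eq_abs, abs_of_pos hs.1, mul_pow]
    ring
  have hpos : 0 ≤ 1 - s ^ 2 * ‖a 0‖ ^ 2 := by
    rw [← mul_pow]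
    have : s * ‖a 0‖ ≤ 1 := mul_le_one₀ hs.2.le (norm_nonneg _) hA
    have := pow_le_one₀ (n := 2) (mul_nonneg hs.1.le (norm_nonneg (a 0))) this
    linarith
  have := mul_le_mul_of_nonneg_left hP hpos
  linarith

theorem coeff_le (f : ℂ → ℂ)
    (hd : DifferentiableOn ℂ f (ball (0 : ℂ) 1))
    (hb : ∀ z ∈ ball (0 : ℂ) 1, ‖f z‖ ≤ 1)
    (a : ℕ → ℂ)
    (ha : ∀ z ∈ ball (0 : ℂ) 1, HasSum (fun n : ℕ => a n * z ^ n) (f z))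
    (N : ℕ) (p : ℝ) (hp0 : 0 < p) (hp1 : p ≤ 1) (hf0 : f 0 = a 0) :
    (1 - p * ‖a 0‖ ^ 2) * ∑ n ∈ Finset.range N, ‖a (n + 1)‖ ^ 2 * p ^ (n + 1) ≤
      p * (1 - ‖a 0‖ ^ 2) ^ 2 := by
  have hcl : Real.sqrt p ∈ closure (Set.Ioo (0:ℝ) 1) := by
    rw [closure_Ioo (by norm_num)]
    exact ⟨Real.sqrt_nonneg _, Real.sqrt_le_one.mpr hp1⟩
  have := ContinuousWithinAt.closure_le hcl
    (f := fun s : ℝ => (1 - s ^ 2 * ‖a 0‖ ^ 2) *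
      ∑ n ∈ Finset.range N, ‖a (n + 1)‖ ^ 2 * (s ^ 2) ^ (n + 1))
    (g := fun s : ℝ => s ^ 2 * (1 - ‖a 0‖ ^ 2) ^ 2)
    (Continuous.continuousWithinAt (by fun_prop))
    (Continuous.continuousWithinAt (by fun_prop))
    (fun s hs => coeff_lt f hd hb a ha N s hs hf0)
  simpa only [Real.sq_sqrt hp0.le] using this

theorem tail_aux (f : ℂ → ℂ)
    (hd : DifferentiableOn ℂ f (ball (0 : ℂ) 1))
    (hb : ∀ z ∈ ball (0 : ℂ) 1, ‖f z‖ ≤ 1)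
    (a : ℕ → ℂ)
    (ha : ∀ z ∈ ball (0 : ℂ) 1, HasSum (fun n : ℕ => a n * z ^ n) (f z))
    (hf0 : f 0 = a 0) (r p q B : ℝ) (hr0 : 0 < r) (hp0 : 0 < p) (hp1 : p ≤ 1)
    (hq0 : 0 < q) (hq1 : q < 1) (hpq : r ^ 2 = p * q) (hpa : 0 < 1 - p * ‖a 0‖ ^ 2)
    (hB0 : 0 ≤ B)
    (hB : p * (1 - ‖a 0‖ ^ 2) ^ 2 / (1 - p * ‖a 0‖ ^ 2) * (q / (1 - q)) ≤ B ^ 2) :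
    ∑' n : ℕ, ‖a (n + 1)‖ * r ^ (n + 1) ≤ B := by
  apply Real.tsum_le_of_sum_range_le
  · intro n; positivity
  intro N
  apply le_of_sq_le_sq _ hB0
  refine le_trans ?_ hB
  have h1 := Finset.sum_sq_le_sum_mul_sum_of_sq_eq_mul (Finset.range N)
    (r := fun n => ‖a (n + 1)‖ * r ^ (n + 1)) (f := fun n => ‖a (n + 1)‖ ^ 2 * p ^ (n + 1))
    (g := fun n => q ^ (n + 1)) (fun i _ => by positivity) (fun i _ => by positivity)
    (fun i _ => by
      rw [mul_pow, ← pow_mul, mul_comm (i + 1) 2, pow_mul, hpq, mul_pow]; ring)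
  refine h1.trans ?_
  have h2 : ∑ n ∈ Finset.range N, q ^ (n + 1) ≤ q / (1 - q) := by
    have hg := (hasSum_geometric_of_lt_one hq0.le hq1).mul_left q
    have := sum_le_hasSum (Finset.range N) (fun i _ => by positivity) hg
    simpa only [pow_succ', div_eq_mul_inv] using this
  have h3 := coeff_le f hd hb a ha N p hp0 hp1 hf0
  rw [mul_comm, ← le_div_iff₀ hpa] at h3
  apply mul_le_mul h3 h2
  · exact Finset.sum_nonneg fun i _ => by positivity
  · positivity

/-- For `f ∈ 𝓑` with Taylor coefficients `aₙ` and `0 < r < 1`: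
if `‖a₀‖ ≥ r` then `Σ_{n≥1} ‖aₙ‖ rⁿ ≤ r(1 − ‖a₀‖²)/(1 − r‖a₀‖)`, and
if `‖a₀‖ < r` then `Σ_{n≥1} ‖aₙ‖ rⁿ ≤ r √(1 − ‖a₀‖²)/√(1 − r²)`. -/
theorem tail_coeff_bound (f : ℂ → ℂ)
    (hd : DifferentiableOn ℂ f (ball (0 : ℂ) 1))
    (hb : ∀ z ∈ ball (0 : ℂ) 1, ‖f z‖ ≤ 1)
    (a : ℕ → ℂ)
    (ha : ∀ z ∈ ball (0 : ℂ) 1, HasSum (fun n : ℕ => a n * z ^ n) (f z))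
    (r : ℝ) (hr0 : 0 < r) (hr1 : r < 1) :
    (r ≤ ‖a 0‖ →
      ∑' n : ℕ, ‖a (n + 1)‖ * r ^ (n + 1) ≤ r * (1 - ‖a 0‖ ^ 2) / (1 - r * ‖a 0‖)) ∧
    (‖a 0‖ < r →
      ∑' n : ℕ, ‖a (n + 1)‖ * r ^ (n + 1) ≤
        r * Real.sqrt (1 - ‖a 0‖ ^ 2) / Real.sqrt (1 - r ^ 2)) := by
  have h0 : (0 : ℂ) ∈ ball (0 : ℂ) 1 := by simp
  have hf0 : f 0 = a 0 := by
    refine (ha 0 h0).unique ?_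
    have := hasSum_single (f := fun n : ℕ => a n * (0:ℂ) ^ n) 0 (fun n hn => by simp [hn])
    simpa using this
  have hA : ‖a 0‖ ≤ 1 := by rw [← hf0]; exact hb 0 h0
  constructor
  · intro h
    generalize hAe : ‖a 0‖ = A at *
    have hA0 : 0 < A := hr0.trans_le h
    have hrA : 0 < 1 - r * A := by nlinarith
    have e : r / A * A ^ 2 = r * A := by field_simp
    apply tail_aux f hd hb a ha hf0 r (r / A) (r * A) _ hr0 (by positivity)
      ((div_le_one hA0).mpr h) (by positivity) (by linarith) (by field_simp)
    · rw [hAe, e]; exact hrA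
    · have : 0 ≤ 1 - A ^ 2 := by nlinarith
      positivity
    · rw [hAe, e]
      apply le_of_eq
      field_simp
  · intro h
    have hr2 : 0 < 1 - r ^ 2 := by nlinarith
    have hA2 : 0 < 1 - ‖a 0‖ ^ 2 := by nlinarith [norm_nonneg (a 0)]
    apply tail_aux f hd hb a ha hf0 r 1 (r ^ 2) _ hr0 one_pos le_rfl (by positivity) (by linarith)
      (by ring) (by linarith) (by positivity)
    rw [div_pow, mul_pow, Real.sq_sqrt hA2.le, Real.sq_sqrt hr2.le]
    apply le_of_eq
    simp only [one_mul]
    field_simp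
end

section
/- Let φ : 𝓑 × [0,1/3] → [0,∞) and 0 ≤ R ≤ 1/3, and assume: (i) φ(f,r) ≤ φ(φ_{|a₀|}, r) for every f ∈ 𝓑 with constant term a₀ and every 0 ≤ r ≤ 1/3; (ii) inf over 0 ≤ a ≤ 1 and 0 ≤ s ≤ R of Υ(φ_a,s)/φ(φ_a,s) is ≤ inf over 0 ≤ s ≤ R of inf over 0 ≤ a ≤ s of (1 − a − s√(1−a²)/√(1−s²))/φ(φ_a,s). Then the sharp constant is Λ_φ(R) = inf { Υ(φ_a,r)/φ(φ_a,r) : 0 ≤ a ≤ 1, 0 ≤ r ≤ R }. -/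
open Metric

/-- The `n`-th Taylor coefficient of `f` at `0`. -/
noncomputable def taylorCoeff (f : ℂ → ℂ) (n : ℕ) : ℂ :=
  iteratedDeriv n f 0 / n.factorial

/-- The class `𝓑` of holomorphic functions on the unit disc bounded by `1`. -/
def memB (f : ℂ → ℂ) : Prop :=
  DifferentiableOn ℂ f (ball (0 : ℂ) 1) ∧ ∀ z ∈ ball (0 : ℂ) 1, ‖f z‖ ≤ 1

/-- `Σ_{n≥0} |aₙ| rⁿ`, the Bohr sum of `f` at radius `r`. -/
noncomputable def bohrSum (f : ℂ → ℂ) (r : ℝ) : ℝ :=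
  ∑' n : ℕ, ‖taylorCoeff f n‖ * r ^ n

/-- The sharp constant `Λ_φ(R)`. -/
noncomputable def sharpConstant (φ : (ℂ → ℂ) → ℝ → ℝ) (R : ℝ) : ℝ :=
  sSup {l : ℝ | 0 ≤ l ∧
    ∀ f, memB f → ∀ r, 0 ≤ r → r ≤ R → bohrSum f r + l * φ f r ≤ 1}

/-- The Möbius-type map `φ_a(z) = (z − a)/(1 − a z)`. -/
noncomputable def mobius (a : ℝ) : ℂ → ℂ := fun z => (z - (a : ℂ)) / (1 - (a : ℂ) * z)

/-- The set of quotients `Υ(φ_a, r)/φ(φ_a, r)` for `0 ≤ a ≤ 1` and `0 ≤ r ≤ R`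
(quotients with vanishing denominator being omitted). -/
def mobiusQuotients (φ : (ℂ → ℂ) → ℝ → ℝ) (R : ℝ) : Set ℝ :=
  {x : ℝ | ∃ b, 0 ≤ b ∧ b ≤ 1 ∧ ∃ t, 0 ≤ t ∧ t ≤ R ∧ 0 < φ (mobius b) t ∧
    x = (1 - bohrSum (mobius b) t) / φ (mobius b) t}


section Helpers

open Complex ComplexConjugate Filter Topology

instance hlpFact : Fact ((0 : ℝ) < 1) := ⟨one_pos⟩

lemma hlp_key (c w : ℂ) (hc : ‖c‖ ≤ 1) (hw : ‖w‖ ≤ 1) :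
    ‖w - c‖ ≤ ‖1 - conj c * w‖ := by
  have h1 : c.re ^ 2 + c.im ^ 2 ≤ 1 := by
    have := Complex.sq_norm c
    rw [Complex.normSq_apply] at this
    nlinarith [norm_nonneg c]
  have h2 : w.re ^ 2 + w.im ^ 2 ≤ 1 := by
    have := Complex.sq_norm w
    rw [Complex.normSq_apply] at this
    nlinarith [norm_nonneg w]
  rw [← abs_of_nonneg (norm_nonneg (w - c)), ← abs_of_nonneg (norm_nonneg (1 - conj c * w)),
    ← sq_le_sq, Complex.sq_norm, Complex.sq_norm, Complex.normSq_apply, Complex.normSq_apply]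
  simp
  nlinarith [mul_nonneg (sub_nonneg.2 h1) (sub_nonneg.2 h2)]

lemma hlp_hasSum {f : ℂ → ℂ} (hf : memB f) {z : ℂ} (hz : z ∈ ball (0 : ℂ) 1) :
    HasSum (fun n => taylorCoeff f n * z ^ n) (f z) := by
  have := Complex.hasSum_taylorSeries_on_ball hf.1 hz
  have e : (fun n => taylorCoeff f n * z ^ n) =
      (fun n : ℕ => ((n.factorial : ℂ))⁻¹ • (z - 0) ^ n • iteratedDeriv n f 0) := by
    funext n
    simp only [taylorCoeff, div_eq_mul_inv, smul_eq_mul, sub_zero]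
    ring
  rw [e]
  exact this

lemma hlp_coeff_eq {f : ℂ → ℂ} (hf : memB f) {c : ℕ → ℂ}
    (h : ∀ z ∈ ball (0 : ℂ) 1, HasSum (fun n => c n * z ^ n) (f z)) :
    taylorCoeff f = c := by
  have key : ∀ d : ℕ → ℂ, (∀ z ∈ ball (0 : ℂ) 1, HasSum (fun n => d n * z ^ n) (f z)) →
      HasFPowerSeriesAt f (FormalMultilinearSeries.ofScalars ℂ d) 0 := by
    intro d hd
    rw [hasFPowerSeriesAt_iff]
    filter_upwards [ball_mem_nhds (0 : ℂ) one_pos] with z hz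
    simpa [FormalMultilinearSeries.coeff_ofScalars, mul_comm] using hd z hz
  have := (key _ (fun z hz => hlp_hasSum hf hz)).eq_formalMultilinearSeries (key _ h)
  exact FormalMultilinearSeries.ofScalars_series_injective ℂ ℂ this

lemma hlp_coeff_zero (f : ℂ → ℂ) : taylorCoeff f 0 = f 0 := by
  simp [taylorCoeff]

/-- Schwarz–Pick at the origin. -/
lemma hlp_pick {f : ℂ → ℂ} (hf : memB f) {z : ℂ} (hz : z ∈ ball (0 : ℂ) 1) :
    ‖f z - f 0‖ ≤ ‖z‖ * ‖1 - conj (f 0) * f z‖ := by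
  have h0 : (0 : ℂ) ∈ ball (0 : ℂ) 1 := by simp
  have main : ∀ t : ℝ, 0 < t → t < 1 →
      ‖t * f z - t * f 0‖ ≤ ‖z‖ * ‖1 - conj (t * f 0) * (t * f z)‖ := by
    intro t ht0 ht1
    have hlt : ∀ w ∈ ball (0 : ℂ) 1, ‖(t : ℂ) * f w‖ < 1 := by
      intro w hw
      have := hf.2 w hw
      rw [norm_mul, Complex.norm_real, Real.norm_of_nonneg ht0.le]
      nlinarith [norm_nonneg (f w)]
    have hne : ∀ w ∈ ball (0 : ℂ) 1, 1 - conj (t * f 0) * (t * f w) ≠ 0 := by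
      intro w hw h
      have h1 : conj (t * f 0) * (t * f w) = 1 := (sub_eq_zero.1 h).symm
      have h2 := congrArg norm h1
      rw [norm_mul, RCLike.norm_conj, norm_one] at h2
      nlinarith [hlt w hw, hlt 0 h0, norm_nonneg ((t : ℂ) * f w), norm_nonneg ((t : ℂ) * f 0)]
    set g : ℂ → ℂ := fun w => (t * f w - t * f 0) / (1 - conj (t * f 0) * (t * f w)) with hg
    have hg0 : g 0 = 0 := by simp [hg]
    have hd : DifferentiableOn ℂ g (ball 0 1) := by
      apply DifferentiableOn.div _ _ hne
      · exact (hf.1.const_mul _).sub_const _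
      · exact ((hf.1.const_mul _).const_mul _).const_sub _
    have hm : Set.MapsTo g (ball 0 1) (closedBall (g 0) 1) := by
      intro w hw
      rw [hg0, mem_closedBall, dist_zero_right, hg, norm_div]
      apply div_le_one_of_le₀ _ (norm_nonneg _)
      exact hlp_key _ _ (hlt 0 h0).le (hlt w hw).le
    have := Complex.dist_le_div_mul_dist_of_mapsTo_ball hd hm hz
    rw [hg0, dist_zero_right, dist_zero_right, hg, norm_div, div_one, one_mul,
      div_le_iff₀ (norm_pos_iff.2 (hne z hz))] at this
    exact this
  have hev : ∀ᶠ t : ℝ in 𝓝[<] 1,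
      ‖t * f z - t * f 0‖ ≤ ‖z‖ * ‖1 - conj (t * f 0) * (t * f z)‖ := by
    filter_upwards [Ioo_mem_nhdsLT (zero_lt_one' ℝ)] with t ht
    exact main t ht.1 ht.2
  have c1 : Continuous fun t : ℝ => ‖(t : ℂ) * f z - t * f 0‖ := by fun_prop
  have c2 : Continuous fun t : ℝ => ‖z‖ * ‖1 - conj ((t : ℂ) * f 0) * (t * f z)‖ := by
    simp only [map_mul, Complex.conj_ofReal]
    fun_prop
  have := le_of_tendsto_of_tendsto (c1.continuousWithinAt (s := Set.Iio 1) (x := 1)).tendsto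
    (c2.continuousWithinAt (s := Set.Iio 1) (x := 1)).tendsto hev
  simpa using this

/-- Parseval for absolutely convergent power series on the circle. -/
lemma hlp_parseval (c : ℕ → ℂ) (hc : Summable fun n => ‖c n‖) :
    ∃ F : C(AddCircle (1 : ℝ), ℂ),
      (∀ x, HasSum (fun n => c n * (fourier 1 x) ^ n) (F x)) ∧
      HasSum (fun n => ‖c n‖ ^ 2)
        (‖ContinuousMap.toLp (E := ℂ) 2 AddCircle.haarAddCircle ℂ F‖ ^ 2) := by
  let u : ℕ → C(AddCircle (1 : ℝ), ℂ) := fun n => c n • fourier (n : ℤ)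
  have hu : Summable u := by
    apply Summable.of_norm
    simpa [u, norm_smul, fourier_norm] using hc
  refine ⟨∑' n, u n, ?_, ?_⟩
  · intro x
    have := (ContinuousMap.evalCLM ℂ x).hasSum hu.hasSum
    simp only [ContinuousMap.evalCLM_apply] at this
    convert this using 2 with n
    simp only [u, ContinuousMap.evalCLM_apply, ContinuousMap.smul_apply, smul_eq_mul]
    congr 1
    induction n with
    | zero => simp
    | succ k ih => rw [pow_succ, ih, Nat.cast_succ, fourier_add]
  · have h1 := (ContinuousMap.toLp (E := ℂ) 2 (AddCircle.haarAddCircle (T := 1)) ℂ).hasSum hu.hasSum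
    have hinj : Function.Injective (fun n : ℕ => (n : ℤ)) := Nat.cast_injective
    have ho := (orthonormal_fourier (T := 1)).comp _ hinj
    have h2 : ∀ s : Finset ℕ, ‖∑ n ∈ s, ContinuousMap.toLp (E := ℂ) 2
        (AddCircle.haarAddCircle (T := 1)) ℂ (u n)‖ ^ 2 = ∑ n ∈ s, ‖c n‖ ^ 2 := by
      intro s
      have h3 : ∀ n, ContinuousMap.toLp (E := ℂ) 2
        (AddCircle.haarAddCircle (T := 1)) ℂ (u n) = c n • fourierLp 2 (n : ℤ) := by
        intro n
        simp [u, fourierLp]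
      have h4 := ho.inner_sum c c s
      simp only [Function.comp] at h4
      simp only [h3]
      rw [inner_self_eq_norm_sq_to_K] at h4
      have h5 : ∀ i, conj (c i) * c i = ((‖c i‖ ^ 2 : ℝ) : ℂ) := by
        intro i
        rw [Complex.conj_mul', Complex.ofReal_pow]
      simp only [h5] at h4
      rw [← Complex.ofReal_sum] at h4
      apply Complex.ofReal_injective
      rw [Complex.ofReal_pow]
      exact h4
    have h6 : Tendsto (fun s : Finset ℕ => ‖∑ n ∈ s, ContinuousMap.toLp (E := ℂ) 2
        (AddCircle.haarAddCircle (T := 1)) ℂ (u n)‖ ^ 2) atTop _ := (Tendsto.norm h1).pow 2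
    simp only [h2] at h6
    exact h6

lemma hlp_parseval_le (c d : ℕ → ℂ) (hc : Summable fun n => ‖c n‖) (hd : Summable fun n => ‖d n‖)
    (h : ∀ z : ℂ, ‖z‖ = 1 → ‖∑' n, c n * z ^ n‖ ≤ ‖∑' n, d n * z ^ n‖) :
    ∑' n, ‖c n‖ ^ 2 ≤ ∑' n, ‖d n‖ ^ 2 := by
  obtain ⟨F, hF1, hF2⟩ := hlp_parseval c hc
  obtain ⟨G, hG1, hG2⟩ := hlp_parseval d hd
  rw [hF2.tsum_eq, hG2.tsum_eq]
  gcongr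
  apply MeasureTheory.Lp.norm_le_norm_of_ae_le
  filter_upwards [ContinuousMap.coeFn_toLp (p := 2) (𝕜 := ℂ) AddCircle.haarAddCircle F,
    ContinuousMap.coeFn_toLp (p := 2) (𝕜 := ℂ) AddCircle.haarAddCircle G] with x hx hy
  rw [hx, hy, ← (hF1 x).tsum_eq, ← (hG1 x).tsum_eq]
  apply h
  rw [fourier_apply]
  exact Circle.norm_coe _

lemma hlp_congr {E : Type*} [AddCommMonoid E] [TopologicalSpace E] {f g : ℕ → E} {a : E}
    (h : ∀ n, f n = g n) (hg : HasSum g a) : HasSum f a := by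
  rwa [show f = g from funext h]

lemma hlp_S_lt {f : ℂ → ℂ} (hf : memB f) (s : ℝ) (hs0 : 0 ≤ s) (hs1 : s < 1) (N : ℕ) :
    (∑ k ∈ Finset.range N, ‖taylorCoeff f (k + 1)‖ ^ 2 * s ^ (2 * (k + 1))) *
      (1 - ‖f 0‖ ^ 2 * s ^ 2) ≤ s ^ 2 * (1 - ‖f 0‖ ^ 2) ^ 2 := by
  have ha : ‖f 0‖ ≤ 1 := hf.2 0 (by simp)
  set b := taylorCoeff f with hb
  have hmem : ∀ z : ℂ, ‖z‖ = 1 → (s : ℂ) * z ∈ ball (0 : ℂ) 1 := by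
    intro z hz
    simpa [hz, abs_of_nonneg hs0] using hs1
  have hsum : ∀ z : ℂ, ‖z‖ = 1 → HasSum (fun n => b n * s ^ n * z ^ n) (f (s * z)) := by
    intro z hz
    have := hlp_hasSum hf (hmem z hz)
    simpa only [mul_pow, mul_assoc] using this
  have hsb : Summable fun n => ‖b n * (s : ℂ) ^ n‖ := by
    have := (hsum 1 (by simp)).summable.norm
    simpa using this
  let e : ℕ → ℂ := fun n => if n = 0 then 1 else 0
  have he : ∀ z : ℂ, HasSum (fun n => e n * z ^ n) 1 := by
    intro z
    convert hasSum_ite_eq (0 : ℕ) (1 : ℂ) using 2 with n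
    by_cases h : n = 0 <;> simp [e, h]
  have hes : Summable fun n => ‖e n‖ := by
    have := (he 1).summable.norm
    simpa using this
  let c : ℕ → ℂ := fun n => b n * s ^ n - f 0 * e n
  let d : ℕ → ℂ := fun n => s * (e n - conj (f 0) * (b n * s ^ n))
  have hc : Summable fun n => ‖c n‖ := by
    refine Summable.of_nonneg_of_le (fun _ => norm_nonneg _) (fun n => norm_sub_le _ _)
      (hsb.add ?_)
    simpa [norm_mul] using hes.mul_left ‖f 0‖
  have hd : Summable fun n => ‖d n‖ := by
    have : Summable fun n => ‖e n - conj (f 0) * (b n * (s : ℂ) ^ n)‖ := by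
      refine Summable.of_nonneg_of_le (fun _ => norm_nonneg _) (fun n => norm_sub_le _ _)
        (hes.add ?_)
      simpa only [norm_mul] using hsb.mul_left ‖conj (f 0)‖
    simpa only [d, norm_mul] using this.mul_left ‖(s : ℂ)‖
  have hle := hlp_parseval_le c d hc hd (by
    intro z hz
    have h1 : HasSum (fun n => c n * z ^ n) (f (s * z) - f 0) := by
      have := (hsum z hz).sub ((he z).mul_left (f 0))
      rw [mul_one] at this
      refine hlp_congr (fun n => ?_) this
      simp only [c]; ring
    have h2 : HasSum (fun n => d n * z ^ n) (s * (1 - conj (f 0) * f (s * z))) := by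
      have := ((he z).sub ((hsum z hz).mul_left (conj (f 0)))).mul_left (s : ℂ)
      refine hlp_congr (fun n => ?_) this
      simp only [d]; ring
    rw [h1.tsum_eq, h2.tsum_eq, norm_mul]
    have := hlp_pick hf (hmem z hz)
    rwa [norm_mul, hz, mul_one] at this)
  have hsq : ∀ g : ℕ → ℂ, (Summable fun n => ‖g n‖) → Summable fun n => ‖g n‖ ^ 2 := by
    intro g hg
    obtain ⟨F, _, hF⟩ := hlp_parseval g hg
    exact hF.summable
  have hc2 := hsq c hc
  have hd2 := hsq d hd
  rw [hc2.tsum_eq_zero_add, hd2.tsum_eq_zero_add] at hle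
  have hb0 : b 0 = f 0 := hlp_coeff_zero f
  have c0 : ‖c 0‖ ^ 2 = 0 := by simp [c, e, hb0]
  have d0 : ‖d 0‖ ^ 2 = s ^ 2 * (1 - ‖f 0‖ ^ 2) ^ 2 := by
    have : d 0 = ((s * (1 - ‖f 0‖ ^ 2) : ℝ) : ℂ) := by
      simp [d, e, hb0, Complex.conj_mul']
    rw [this, Complex.norm_real, Real.norm_eq_abs, sq_abs]; ring
  have cs : ∀ n, ‖c (n + 1)‖ ^ 2 = ‖b (n + 1)‖ ^ 2 * s ^ (2 * (n + 1)) := by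
    intro n
    simp [c, e, abs_of_nonneg hs0]; ring
  have ds : ∀ n, ‖d (n + 1)‖ ^ 2 = s ^ 2 * ‖f 0‖ ^ 2 * (‖b (n + 1)‖ ^ 2 * s ^ (2 * (n + 1))) := by
    intro n
    simp [d, e, abs_of_nonneg hs0]; ring
  have hS : Summable fun n => ‖b (n + 1)‖ ^ 2 * s ^ (2 * (n + 1)) := by
    have := (summable_nat_add_iff 1).2 hc2
    simpa only [cs] using this
  rw [c0, d0] at hle
  simp only [cs, ds, tsum_mul_left] at hle
  have hfin := hS.sum_le_tsum (Finset.range N) (fun i _ => by positivity)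
  have hpos : 0 ≤ 1 - ‖f 0‖ ^ 2 * s ^ 2 := by
    have : ‖f 0‖ * s ≤ 1 := mul_le_one₀ ha hs0 hs1.le
    nlinarith [mul_nonneg (norm_nonneg (f 0)) hs0]
  have := mul_le_mul_of_nonneg_right hfin hpos
  linarith

lemma hlp_S {f : ℂ → ℂ} (hf : memB f) (s : ℝ) (hs0 : 0 ≤ s) (hs1 : s ≤ 1) (N : ℕ) :
    (∑ k ∈ Finset.range N, ‖taylorCoeff f (k + 1)‖ ^ 2 * s ^ (2 * (k + 1))) *
      (1 - ‖f 0‖ ^ 2 * s ^ 2) ≤ s ^ 2 * (1 - ‖f 0‖ ^ 2) ^ 2 := by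
  rcases hs1.lt_or_eq with h | rfl
  · exact hlp_S_lt hf s hs0 h N
  · have hev : ∀ᶠ s : ℝ in 𝓝[<] 1,
      (∑ k ∈ Finset.range N, ‖taylorCoeff f (k + 1)‖ ^ 2 * s ^ (2 * (k + 1))) *
      (1 - ‖f 0‖ ^ 2 * s ^ 2) ≤ s ^ 2 * (1 - ‖f 0‖ ^ 2) ^ 2 := by
      filter_upwards [Ioo_mem_nhdsLT (zero_lt_one' ℝ)] with t ht
      exact hlp_S_lt hf t ht.1.le ht.2 N
    have c1 : Continuous fun s : ℝ =>
      (∑ k ∈ Finset.range N, ‖taylorCoeff f (k + 1)‖ ^ 2 * s ^ (2 * (k + 1))) *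
      (1 - ‖f 0‖ ^ 2 * s ^ 2) := by fun_prop
    have c2 : Continuous fun s : ℝ => s ^ 2 * (1 - ‖f 0‖ ^ 2) ^ 2 := by fun_prop
    exact le_of_tendsto_of_tendsto (c1.continuousWithinAt (s := Set.Iio 1) (x := 1)).tendsto
      (c2.continuousWithinAt (s := Set.Iio 1) (x := 1)).tendsto hev

lemma hlp_T {f : ℂ → ℂ} (hf : memB f) (r s B : ℝ) (hr : 0 ≤ r) (hrs : r < s) (hs1 : s ≤ 1)
    (has : ‖f 0‖ ^ 2 * s ^ 2 < 1) (hB : 0 ≤ B)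
    (h : s ^ 2 * (1 - ‖f 0‖ ^ 2) ^ 2 * r ^ 2 ≤
      B ^ 2 * ((1 - ‖f 0‖ ^ 2 * s ^ 2) * (s ^ 2 - r ^ 2))) :
    bohrSum f r ≤ ‖f 0‖ + B := by
  have hs0 : 0 < s := lt_of_le_of_lt hr hrs
  have hrs2 : 0 < s ^ 2 - r ^ 2 := by nlinarith
  have main : ∀ N, ∑ k ∈ Finset.range N, ‖taylorCoeff f (k + 1)‖ * r ^ (k + 1) ≤ B := by
    intro N
    have hS := hlp_S hf s hs0.le hs1 N
    have hCS := Finset.sum_mul_sq_le_sq_mul_sq (Finset.range N)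
      (fun k => ‖taylorCoeff f (k + 1)‖ * s ^ (k + 1)) (fun k => (r / s) ^ (k + 1))
    have e1 : ∀ k : ℕ, ‖taylorCoeff f (k + 1)‖ * s ^ (k + 1) * (r / s) ^ (k + 1) =
        ‖taylorCoeff f (k + 1)‖ * r ^ (k + 1) := by
      intro k
      rw [mul_assoc, ← mul_pow, mul_div_cancel₀ _ hs0.ne']
    have e2 : ∀ k : ℕ, (‖taylorCoeff f (k + 1)‖ * s ^ (k + 1)) ^ 2 =
        ‖taylorCoeff f (k + 1)‖ ^ 2 * s ^ (2 * (k + 1)) := by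
      intro k; ring
    have e3 : ∀ k : ℕ, ((r / s) ^ (k + 1)) ^ 2 = (r / s) ^ 2 * ((r / s) ^ 2) ^ k := by
      intro k; ring
    simp only [e1, e2, e3, ← Finset.mul_sum] at hCS
    set A := ∑ k ∈ Finset.range N, ‖taylorCoeff f (k + 1)‖ * r ^ (k + 1) with hA
    set X := ∑ k ∈ Finset.range N, ‖taylorCoeff f (k + 1)‖ ^ 2 * s ^ (2 * (k + 1)) with hX
    have hX0 : 0 ≤ X := Finset.sum_nonneg fun _ _ => by positivity
    set G := ∑ k ∈ Finset.range N, ((r / s) ^ 2) ^ k with hG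
    have hG0 : 0 ≤ G := Finset.sum_nonneg fun _ _ => by positivity
    have hgeo : G * (1 - (r / s) ^ 2) = 1 - ((r / s) ^ 2) ^ N := geom_sum_mul_neg _ N
    have hgeo' : G * (1 - (r / s) ^ 2) ≤ 1 := by
      rw [hgeo]
      have : 0 ≤ ((r / s) ^ 2) ^ N := by positivity
      linarith
    have hY : (r / s) ^ 2 * G * (s ^ 2 - r ^ 2) ≤ r ^ 2 := by
      have e : (r / s) ^ 2 * G * (s ^ 2 - r ^ 2) = r ^ 2 * (G * (1 - (r / s) ^ 2)) := by
        field_simp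
      rw [e]
      nlinarith [sq_nonneg r]
    have hp1 : 0 < 1 - ‖f 0‖ ^ 2 * s ^ 2 := by linarith
    have h3 : A ^ 2 * ((1 - ‖f 0‖ ^ 2 * s ^ 2) * (s ^ 2 - r ^ 2)) ≤
        B ^ 2 * ((1 - ‖f 0‖ ^ 2 * s ^ 2) * (s ^ 2 - r ^ 2)) := by
      calc A ^ 2 * ((1 - ‖f 0‖ ^ 2 * s ^ 2) * (s ^ 2 - r ^ 2))
          ≤ (X * ((r / s) ^ 2 * G)) * ((1 - ‖f 0‖ ^ 2 * s ^ 2) * (s ^ 2 - r ^ 2)) :=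
            mul_le_mul_of_nonneg_right hCS (by positivity)
        _ = (X * (1 - ‖f 0‖ ^ 2 * s ^ 2)) * ((r / s) ^ 2 * G * (s ^ 2 - r ^ 2)) := by ring
        _ ≤ (s ^ 2 * (1 - ‖f 0‖ ^ 2) ^ 2) * r ^ 2 :=
            mul_le_mul hS hY (by positivity) (by positivity)
        _ ≤ _ := h
    have h4 : A ^ 2 ≤ B ^ 2 := le_of_mul_le_mul_right h3 (mul_pos hp1 hrs2)
    exact le_of_sq_le_sq h4 hB
  apply Real.tsum_le_of_sum_range_le (fun n => by positivity)
  intro n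
  calc ∑ i ∈ Finset.range n, ‖taylorCoeff f i‖ * r ^ i
      ≤ ∑ i ∈ Finset.range (n + 1), ‖taylorCoeff f i‖ * r ^ i := by
        rw [Finset.sum_range_succ]
        have : 0 ≤ ‖taylorCoeff f n‖ * r ^ n := by positivity
        linarith
    _ ≤ ‖f 0‖ + B := by
        rw [Finset.sum_range_succ', hlp_coeff_zero]
        have := main n
        simp only [pow_zero, mul_one]
        linarith

lemma hlp_U1 {f : ℂ → ℂ} (hf : memB f) (r : ℝ) (hr : 0 ≤ r) (hr1 : r ≤ 1 / 3)
    (hra : r ≤ ‖f 0‖) : bohrSum f r ≤ ‖f 0‖ + (1 - ‖f 0‖ ^ 2) * r / (1 - ‖f 0‖ * r) := by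
  have ha : ‖f 0‖ ≤ 1 := hf.2 0 (by simp)
  have ha2 : ‖f 0‖ ^ 2 ≤ 1 := by nlinarith [norm_nonneg (f 0)]
  have har : 0 < 1 - ‖f 0‖ * r := by nlinarith
  rcases hr.eq_or_lt with rfl | hr0
  · apply hlp_T hf 0 (1 / 2) _ le_rfl (by norm_num) (by norm_num)
    · nlinarith
    · simp
    · simp
  · have ha0 : 0 < ‖f 0‖ := lt_of_lt_of_le hr0 hra
    have hs2 : Real.sqrt (r / ‖f 0‖) ^ 2 = r / ‖f 0‖ := Real.sq_sqrt (by positivity)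
    apply hlp_T hf r (Real.sqrt (r / ‖f 0‖)) _ hr
    · apply Real.lt_sqrt_of_sq_lt
      rw [lt_div_iff₀ ha0]
      nlinarith
    · rw [Real.sqrt_le_one]
      exact div_le_one_of_le₀ hra ha0.le
    · rw [hs2]
      have : ‖f 0‖ ^ 2 * (r / ‖f 0‖) = ‖f 0‖ * r := by field_simp
      linarith
    · apply div_nonneg _ har.le
      apply mul_nonneg _ hr
      linarith
    · rw [hs2]
      apply le_of_eq
      generalize ‖f 0‖ = a at *
      have e1 : 1 - a ^ 2 * (r / a) = 1 - a * r := by field_simp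
      have e2 : r / a - r ^ 2 = (r / a) * (1 - a * r) := by field_simp
      rw [e1, e2]
      generalize hw : 1 - a * r = w at *
      field_simp

lemma hlp_U2 {f : ℂ → ℂ} (hf : memB f) (r : ℝ) (hr : 0 ≤ r) (hr1 : r ≤ 1 / 3)
    (hra : ‖f 0‖ ≤ r) :
    bohrSum f r ≤ ‖f 0‖ + r * Real.sqrt (1 - ‖f 0‖ ^ 2) / Real.sqrt (1 - r ^ 2) := by
  have ha2 : ‖f 0‖ ^ 2 < 1 := by nlinarith [norm_nonneg (f 0)]
  have hr2 : 0 < 1 - r ^ 2 := by nlinarith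
  apply hlp_T hf r 1 _ hr (by linarith) le_rfl (by linarith) (by positivity)
  rw [div_pow, mul_pow, Real.sq_sqrt (by linarith), Real.sq_sqrt hr2.le]
  apply le_of_eq
  field_simp

lemma hlp_bohr {f : ℂ → ℂ} (hf : memB f) (r : ℝ) (hr : 0 ≤ r) (hr1 : r ≤ 1 / 3) :
    bohrSum f r ≤ 1 := by
  have ha : ‖f 0‖ ≤ 1 := hf.2 0 (by simp)
  rcases le_total r ‖f 0‖ with h | h
  · refine (hlp_U1 hf r hr hr1 h).trans ?_
    have har : 0 < 1 - ‖f 0‖ * r := by nlinarith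
    have : (1 - ‖f 0‖ ^ 2) * r / (1 - ‖f 0‖ * r) ≤ 1 - ‖f 0‖ := by
      rw [div_le_iff₀ har]
      nlinarith [mul_nonneg (sub_nonneg.2 ha) (by nlinarith : 0 ≤ 1 - r * (1 + 2 * ‖f 0‖))]
    linarith
  · refine (hlp_U2 hf r hr hr1 h).trans ?_
    have h1 : Real.sqrt (1 - ‖f 0‖ ^ 2) ≤ 1 := by
      rw [Real.sqrt_le_one]
      nlinarith [sq_nonneg ‖f 0‖]
    have h2 : 1 / 2 ≤ Real.sqrt (1 - r ^ 2) := by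
      apply Real.le_sqrt_of_sq_le
      nlinarith
    have : r * Real.sqrt (1 - ‖f 0‖ ^ 2) / Real.sqrt (1 - r ^ 2) ≤ 2 / 3 := by
      rw [div_le_iff₀ (by linarith)]
      nlinarith
    linarith

lemma hlp_mobius_mem (b : ℝ) (hb0 : 0 ≤ b) (hb1 : b ≤ 1) : memB (mobius b) := by
  have hne : ∀ z ∈ ball (0 : ℂ) 1, 1 - (b : ℂ) * z ≠ 0 := by
    intro z hz h
    have h1 : (b : ℂ) * z = 1 := (sub_eq_zero.1 h).symm
    have h2 := congrArg norm h1
    rw [norm_mul, norm_one, Complex.norm_real, Real.norm_of_nonneg hb0] at h2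
    have h3 : ‖z‖ < 1 := by simpa using hz
    nlinarith [norm_nonneg z]
  constructor
  · apply DifferentiableOn.div _ _ hne <;> fun_prop
  · intro z hz
    have h3 : ‖z‖ < 1 := by simpa using hz
    have := hlp_key (b : ℂ) z (by rwa [Complex.norm_real, Real.norm_of_nonneg hb0]) h3.le
    rw [Complex.conj_ofReal] at this
    rw [mobius, norm_div]
    exact div_le_one_of_le₀ this (norm_nonneg _)

lemma hlp_mobius_sum (b : ℝ) (hb0 : 0 ≤ b) (hb1 : b ≤ 1) (t : ℝ) (ht0 : 0 ≤ t) (ht1 : t ≤ 1 / 3) :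
    bohrSum (mobius b) t = b + (1 - b ^ 2) * t / (1 - b * t) := by
  let c : ℕ → ℂ := fun n => Nat.casesOn n (-(b : ℂ)) (fun k => (1 - (b : ℂ) ^ 2) * (b : ℂ) ^ k)
  have hc : taylorCoeff (mobius b) = c := by
    apply hlp_coeff_eq (hlp_mobius_mem b hb0 hb1)
    intro z hz
    have h3 : ‖z‖ < 1 := by simpa using hz
    have hlt : ‖(b : ℂ) * z‖ < 1 := by
      rw [norm_mul, Complex.norm_real, Real.norm_of_nonneg hb0]
      nlinarith [norm_nonneg z]
    have hne : 1 - (b : ℂ) * z ≠ 0 := by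
      intro h
      rw [← sub_eq_zero.1 h, norm_one] at hlt
      exact lt_irrefl _ hlt
    have h1 := (hasSum_geometric_of_norm_lt_one hlt).mul_left ((1 - (b : ℂ) ^ 2) * z)
    have h2 : HasSum (fun n => c (n + 1) * z ^ (n + 1))
        ((1 - (b : ℂ) ^ 2) * z * (1 - (b : ℂ) * z)⁻¹) := by
      refine hlp_congr (fun n => ?_) h1
      simp only [c]; ring
    rw [hasSum_nat_add_iff (f := fun n => c n * z ^ n) 1] at h2
    have e : mobius b z = (1 - (b : ℂ) ^ 2) * z * (1 - (b : ℂ) * z)⁻¹ +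
        ∑ i ∈ Finset.range 1, c i * z ^ i := by
      have c0 : c 0 = -(b : ℂ) := rfl
      simp only [c0, mobius, Finset.sum_range_one, pow_zero, mul_one]
      rw [div_eq_iff hne, add_mul, mul_assoc _ _ (1 - (b : ℂ) * z), inv_mul_cancel₀ hne]
      ring
    rw [e]
    exact h2
  have hbt : b * t < 1 := by nlinarith
  have h1 := (hasSum_geometric_of_lt_one (by positivity : 0 ≤ b * t) hbt).mul_left
    ((1 - b ^ 2) * t)
  have hb2 : 0 ≤ 1 - b ^ 2 := by nlinarith
  have hn : ∀ n, ‖c (n + 1)‖ = (1 - b ^ 2) * b ^ n := by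
    intro n
    have : c (n + 1) = (((1 - b ^ 2) * b ^ n : ℝ) : ℂ) := by simp [c]
    rw [this, Complex.norm_real, Real.norm_of_nonneg (by positivity)]
  have h2 : HasSum (fun n => ‖c (n + 1)‖ * t ^ (n + 1)) ((1 - b ^ 2) * t * (1 - b * t)⁻¹) := by
    refine hlp_congr (fun n => ?_) h1
    rw [hn]; ring
  rw [hasSum_nat_add_iff (f := fun n => ‖c n‖ * t ^ n) 1] at h2
  rw [bohrSum, hc, h2.tsum_eq]
  simp [c, abs_of_nonneg hb0]
  ring

end Helpers

/-- If (i) `φ(f,r) ≤ φ(φ_{|a₀|}, r)` for all `f ∈ 𝓑` and `0 ≤ r ≤ 1/3`, and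
(ii) the infimum of `Υ(φ_a,s)/φ(φ_a,s)` over `0 ≤ a ≤ 1`, `0 ≤ s ≤ R` is at most the
infimum over `0 ≤ s ≤ R`, `0 ≤ a ≤ s` of `(1 − a − s√(1−a²)/√(1−s²))/φ(φ_a,s)`
(empty infima counting as `+∞`), then the sharp constant is
`Λ_φ(R) = inf { Υ(φ_a,r)/φ(φ_a,r) : 0 ≤ a ≤ 1, 0 ≤ r ≤ R }`. -/
theorem sharpConstant_eq_inf_mobius (φ : (ℂ → ℂ) → ℝ → ℝ)
    (hφ : ∀ f, memB f → ∀ r, 0 ≤ r → r ≤ 1 / 3 → 0 ≤ φ f r)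
    (R : ℝ) (hR0 : 0 ≤ R) (hR : R ≤ 1 / 3)
    (h1 : ∀ f, memB f → ∀ r, 0 ≤ r → r ≤ 1 / 3 → φ f r ≤ φ (mobius ‖f 0‖) r)
    (h2 : ∀ s, 0 ≤ s → s ≤ R → ∀ a, 0 ≤ a → a ≤ s → 0 < φ (mobius a) s →
      sInf (mobiusQuotients φ R) ≤
        (1 - a - s * Real.sqrt (1 - a ^ 2) / Real.sqrt (1 - s ^ 2)) /
          φ (mobius a) s) :
    sharpConstant φ R = sInf (mobiusQuotients φ R) := by
  have hmne : ∀ f, memB f → ‖f 0‖ ≤ 1 := fun f hf => hf.2 0 (by simp)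
  by_cases hne : (mobiusQuotients φ R).Nonempty
  · -- nonempty case
    have hnn : ∀ x ∈ mobiusQuotients φ R, 0 ≤ x := by
      rintro x ⟨b, hb0, hb1, t, ht0, htR, hpos, rfl⟩
      apply div_nonneg _ hpos.le
      have := hlp_bohr (hlp_mobius_mem b hb0 hb1) t ht0 (htR.trans hR)
      linarith
    have hbdd : BddBelow (mobiusQuotients φ R) := ⟨0, hnn⟩
    have hL0 : 0 ≤ sInf (mobiusQuotients φ R) := le_csInf hne hnn
    apply IsGreatest.csSup_eq
    constructor
    · refine ⟨hL0, ?_⟩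
      intro f hf r hr0 hrR
      have hr3 := hrR.trans hR
      have hle := h1 f hf r hr0 hr3
      have hf0 := hφ f hf r hr0 hr3
      rcases (hf0.trans hle).eq_or_lt with h | hpos
      · have : φ f r = 0 := le_antisymm (hle.trans h.symm.le) hf0
        rw [this, mul_zero, add_zero]
        exact hlp_bohr hf r hr0 hr3
      · have hmul := mul_le_mul_of_nonneg_left hle hL0
        rcases le_total r ‖f 0‖ with hra | hra
        · have hq : sInf (mobiusQuotients φ R) ≤
              (1 - bohrSum (mobius ‖f 0‖) r) / φ (mobius ‖f 0‖) r :=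
            csInf_le hbdd ⟨‖f 0‖, norm_nonneg _, hmne f hf, r, hr0, hrR, hpos, rfl⟩
          rw [le_div_iff₀ hpos, hlp_mobius_sum _ (norm_nonneg _) (hmne f hf) r hr0 hr3] at hq
          have := hlp_U1 hf r hr0 hr3 hra
          linarith
        · have hq := h2 r hr0 hrR ‖f 0‖ (norm_nonneg _) hra hpos
          rw [le_div_iff₀ hpos] at hq
          have := hlp_U2 hf r hr0 hr3 hra
          linarith
    · rintro l ⟨hl0, hl⟩
      apply le_csInf hne
      rintro x ⟨b, hb0, hb1, t, ht0, htR, hpos, rfl⟩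
      rw [le_div_iff₀ hpos]
      have := hl _ (hlp_mobius_mem b hb0 hb1) t ht0 htR
      linarith
  · -- empty case: every `φ f r` vanishes
    have hzero : ∀ f, memB f → ∀ r, 0 ≤ r → r ≤ R → φ f r = 0 := by
      intro f hf r hr0 hrR
      have hr3 := hrR.trans hR
      apply le_antisymm _ (hφ f hf r hr0 hr3)
      refine (h1 f hf r hr0 hr3).trans ?_
      by_contra hpos
      exact hne ⟨_, ‖f 0‖, norm_nonneg _, hmne f hf, r, hr0, hrR, not_le.1 hpos, rfl⟩
    rw [Set.not_nonempty_iff_eq_empty.1 hne, Real.sInf_empty, sharpConstant]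
    apply Real.sSup_of_not_bddAbove
    rintro ⟨M, hM⟩
    have hmem : max M 0 + 1 ∈ {l : ℝ | 0 ≤ l ∧
        ∀ f, memB f → ∀ r, 0 ≤ r → r ≤ R → bohrSum f r + l * φ f r ≤ 1} := by
      refine ⟨by positivity, ?_⟩
      intro f hf r hr0 hrR
      rw [hzero f hf r hr0 hrR, mul_zero, add_zero]
      exact hlp_bohr hf r hr0 (hrR.trans hR)
    have := hM hmem
    have := le_max_left M 0
    linarith
end

section
/- If f ∈ 𝓑 with Taylor coefficients a_n, then for every 0 < r ≤ 1/√2 one has S_r(f)/π ≤ r²(1−|a₀|²)²/(1−|a₀|²r²)², and consequently S_r(f)/(π − S_r(f)) ≤ r²(1−|a₀|²)²/((1−r²)(1−r²|a₀|⁴)). -/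
open Metric

/-- `S_r(f) = π Σ_{n≥1} n |aₙ|² r^{2n}`, written in terms of the Taylor coefficients
`a : ℕ → ℂ` of `f` (the `n = 0` term vanishes, so we may sum over all of `ℕ`). -/
noncomputable def Sarea (a : ℕ → ℂ) (r : ℝ) : ℝ :=
  Real.pi * ∑' n : ℕ, (n : ℝ) * ‖a n‖ ^ 2 * r ^ (2 * n)

lemma aux_sum (s t : Finset ℕ) (g : ℕ → ℝ) (hg : ∀ i, 0 ≤ g i)
    (h : ∀ i ∈ s, g i ≠ 0 → i ∈ t) : ∑ i ∈ s, g i ≤ ∑ i ∈ t, g i := by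
  rw [Finset.sum_subset (s₁ := t) (s₂ := s ∪ t) Finset.subset_union_right]
  · exact Finset.sum_le_sum_of_subset_of_nonneg Finset.subset_union_left fun i _ _ => hg i
  · intro i hi hit
    by_contra hne
    rcases Finset.mem_union.1 hi with h1 | h1
    · exact hit (h i h1 hne)
    · exact hit h1

open Polynomial in
lemma aux_poly (P q : ℂ[X]) (M : ℝ) (hP : ∀ z : ℂ, ‖z‖ = 1 → ‖P.eval z‖ ≤ M)
    (s : Finset ℕ) :
    ∑ i ∈ s, ‖(P * q).coeff i‖ ^ 2 ≤ M ^ 2 * ∑ i ∈ q.support, ‖q.coeff i‖ ^ 2 := by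
  have h1 : ∑ i ∈ s, ‖(P * q).coeff i‖ ^ 2 ≤
      ∑ i ∈ (P * q).support, ‖(P * q).coeff i‖ ^ 2 := by
    apply aux_sum _ _ _ (fun i => by positivity)
    intro i _ hi
    rw [Polynomial.mem_support_iff]
    intro h
    simp [h] at hi
  refine h1.trans ?_
  rw [sum_sq_norm_coeff_eq_circleAverage, sum_sq_norm_coeff_eq_circleAverage,
    ← smul_eq_mul (M ^ 2), ← Real.circleAverage_fun_smul]
  have hc : ∀ p : ℂ[X], Continuous (fun z : ℂ => ‖p.eval z‖ ^ 2) := fun p => by fun_prop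
  apply Real.circleAverage_mono
  · exact (hc _).continuousOn.circleIntegrable'
  · exact ((hc q).const_smul (M ^ 2)).continuousOn.circleIntegrable'
  · intro z hz
    have hz1 : ‖z‖ = 1 := by simpa using hz
    have := hP z hz1
    rw [eval_mul, norm_mul, mul_pow, smul_eq_mul]
    gcongr

lemma aux_unif (f : ℂ → ℂ) (hb : ∀ z ∈ ball (0 : ℂ) 1, ‖f z‖ ≤ 1) (a : ℕ → ℂ)
    (ha : ∀ z ∈ ball (0 : ℂ) 1, HasSum (fun n : ℕ => a n * z ^ n) (f z))
    (ρ : ℝ) (h0 : 0 < ρ) (h1 : ρ < 1) (M : ℝ) (hM : 1 < M) :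
    ∀ᶠ N : ℕ in Filter.atTop, ∀ z : ℂ, ‖z‖ = 1 →
      ‖∑ k ∈ Finset.range N, a k * (ρ : ℂ) ^ k * z ^ k‖ ≤ M := by
  have hs : Summable (fun n : ℕ => ‖a n * (ρ : ℂ) ^ n‖) := by
    have : (ρ : ℂ) ∈ ball (0 : ℂ) 1 := by simp [abs_of_pos h0, h1]
    exact (ha _ this).summable.norm
  have ht := tendsto_sum_nat_add (fun n : ℕ => ‖a n * (ρ : ℂ) ^ n‖)
  have he := ht.eventually_lt_const (show (0 : ℝ) < M - 1 by linarith)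
  filter_upwards [he] with N hN z hz
  have hzb : (ρ : ℂ) * z ∈ ball (0 : ℂ) 1 := by simp [hz, abs_of_pos h0, h1]
  have hf := ha _ hzb
  have hs2 := hf.summable.sum_add_tsum_nat_add N
  rw [hf.tsum_eq] at hs2
  have htail : ‖∑' i, a (i + N) * ((ρ : ℂ) * z) ^ (i + N)‖ ≤
      ∑' k, ‖a (k + N) * (ρ : ℂ) ^ (k + N)‖ := by
    apply tsum_of_norm_bounded ((summable_nat_add_iff N).2 hs).hasSum
    intro i
    simp [mul_pow, hz]
  have heq : ∑ k ∈ Finset.range N, a k * (ρ : ℂ) ^ k * z ^ k =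
      f (ρ * z) - ∑' i, a (i + N) * ((ρ : ℂ) * z) ^ (i + N) := by
    rw [← hs2, add_sub_cancel_right]
    exact Finset.sum_congr rfl fun k _ => by ring
  rw [heq]
  have := norm_sub_le (f (ρ * z)) (∑' i, a (i + N) * ((ρ : ℂ) * z) ^ (i + N))
  have := hb _ hzb
  linarith

open Polynomial in
lemma aux_rho (f : ℂ → ℂ) (hb : ∀ z ∈ ball (0 : ℂ) 1, ‖f z‖ ≤ 1) (a : ℕ → ℂ)
    (ha : ∀ z ∈ ball (0 : ℂ) 1, HasSum (fun n : ℕ => a n * z ^ n) (f z))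
    (ρ : ℝ) (h0 : 0 < ρ) (h1 : ρ < 1) (n : ℕ) (hn : 1 ≤ n) (c : ℂ) :
    ∑ k ∈ Finset.range n, ‖a k * (ρ : ℂ) ^ k‖ ^ 2 + ‖a n * (ρ : ℂ) ^ n + a 0 * c‖ ^ 2 ≤
      (1 / ρ) ^ 2 * (1 + ‖c‖ ^ 2) := by
  obtain ⟨N, hN, hNn⟩ := ((aux_unif f hb a ha ρ h0 h1 (1 / ρ)
    (by rw [lt_div_iff₀ h0]; linarith)).and (Filter.eventually_gt_atTop n)).exists
  set P : ℂ[X] := ∑ k ∈ Finset.range N, C (a k * (ρ : ℂ) ^ k) * X ^ k with hPdef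
  set q : ℂ[X] := 1 + C c * X ^ n with hqdef
  have hPc : ∀ k, k < N → P.coeff k = a k * (ρ : ℂ) ^ k := by
    intro k hk
    rw [hPdef, finsetSum_coeff]
    simp only [coeff_C_mul_X_pow]
    simp [hk]
  have hPe : ∀ z : ℂ, ‖z‖ = 1 → ‖P.eval z‖ ≤ 1 / ρ := by
    intro z hz
    have := hN z hz
    rw [hPdef, eval_finsetSum]
    simpa using this
  have key := aux_poly P q (1 / ρ) hPe (Finset.range (n + 1))
  have hq : ∑ i ∈ q.support, ‖q.coeff i‖ ^ 2 ≤ 1 + ‖c‖ ^ 2 := by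
    have h2 : ∑ i ∈ q.support, ‖q.coeff i‖ ^ 2 ≤
        ∑ i ∈ ({0, n} : Finset ℕ), ‖q.coeff i‖ ^ 2 := by
      apply aux_sum _ _ _ (fun i => by positivity)
      intro i _ hi
      by_contra hcon
      simp only [Finset.mem_insert, Finset.mem_singleton, not_or] at hcon
      apply hi
      simp [hqdef, coeff_one, coeff_X_pow, hcon.1, hcon.2]
    refine h2.trans ?_
    rw [Finset.sum_pair (by omega)]
    have hn0 : n ≠ 0 := by omega
    simp [hqdef, coeff_one, coeff_X_pow, hn0, hn0.symm]
  have hPq : ∀ k, (P * q).coeff k = P.coeff k + (if n ≤ k then P.coeff (k - n) * c else 0) := by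
    intro k
    rw [hqdef, mul_add, mul_one, coeff_add, ← mul_assoc, coeff_mul_X_pow']
    simp
  rw [Finset.sum_range_succ] at key
  have e1 : ∑ k ∈ Finset.range n, ‖(P * q).coeff k‖ ^ 2 =
      ∑ k ∈ Finset.range n, ‖a k * (ρ : ℂ) ^ k‖ ^ 2 := by
    apply Finset.sum_congr rfl
    intro k hk
    have hk' := Finset.mem_range.1 hk
    rw [hPq, if_neg (by omega), hPc k (by omega), add_zero]
  have e2 : (P * q).coeff n = a n * (ρ : ℂ) ^ n + a 0 * c := by
    rw [hPq, if_pos le_rfl, hPc n hNn, Nat.sub_self, hPc 0 (by omega)]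
    simp
  rw [e1, e2] at key
  refine key.trans ?_
  gcongr

lemma aux_one (f : ℂ → ℂ) (hb : ∀ z ∈ ball (0 : ℂ) 1, ‖f z‖ ≤ 1) (a : ℕ → ℂ)
    (ha : ∀ z ∈ ball (0 : ℂ) 1, HasSum (fun n : ℕ => a n * z ^ n) (f z))
    (n : ℕ) (hn : 1 ≤ n) (c : ℂ) :
    ∑ k ∈ Finset.range n, ‖a k‖ ^ 2 + ‖a n + a 0 * c‖ ^ 2 ≤ 1 + ‖c‖ ^ 2 := by
  have hL : Filter.Tendsto (fun ρ : ℝ => ∑ k ∈ Finset.range n, ‖a k * (ρ : ℂ) ^ k‖ ^ 2 +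
      ‖a n * (ρ : ℂ) ^ n + a 0 * c‖ ^ 2) (nhdsWithin 1 (Set.Iio 1))
      (nhds (∑ k ∈ Finset.range n, ‖a k‖ ^ 2 + ‖a n + a 0 * c‖ ^ 2)) := by
    have : Continuous (fun ρ : ℝ => ∑ k ∈ Finset.range n, ‖a k * (ρ : ℂ) ^ k‖ ^ 2 +
      ‖a n * (ρ : ℂ) ^ n + a 0 * c‖ ^ 2) := by fun_prop
    have h := (this.tendsto 1).mono_left (nhdsWithin_le_nhds (s := Set.Iio 1))
    simpa only [Complex.ofReal_one, one_pow, mul_one] using h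
  have hR : Filter.Tendsto (fun ρ : ℝ => (1 / ρ) ^ 2 * (1 + ‖c‖ ^ 2))
      (nhdsWithin 1 (Set.Iio 1)) (nhds (1 + ‖c‖ ^ 2)) := by
    have : ContinuousAt (fun ρ : ℝ => (1 / ρ) ^ 2 * (1 + ‖c‖ ^ 2)) 1 := by
      fun_prop (disch := norm_num)
    have h := this.tendsto.mono_left (nhdsWithin_le_nhds (s := Set.Iio 1))
    simpa using h
  refine le_of_tendsto_of_tendsto hL hR ?_
  filter_upwards [Ioo_mem_nhdsLT (show (0 : ℝ) < 1 by norm_num)] with ρ hρ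
  exact aux_rho f hb a ha ρ hρ.1 hρ.2 n hn c

/-- Rogosinski-type bound on the partial sums. -/
lemma aux_rog (f : ℂ → ℂ) (hb : ∀ z ∈ ball (0 : ℂ) 1, ‖f z‖ ≤ 1) (a : ℕ → ℂ)
    (ha : ∀ z ∈ ball (0 : ℂ) 1, HasSum (fun n : ℕ => a n * z ^ n) (f z)) (n : ℕ) :
    ∑ k ∈ Finset.range n, ‖a (k + 1)‖ ^ 2 ≤
      ∑ k ∈ Finset.range n, (1 - ‖a 0‖ ^ 2) ^ 2 * (‖a 0‖ ^ 2) ^ k := by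
  have ha0 : ‖a 0‖ ^ 2 ≤ 1 := by
    have := aux_one f hb a ha 1 le_rfl 0
    simp at this
    nlinarith [sq_nonneg ‖a 1‖]
  induction n with
  | zero => simp
  | succ n ih =>
    have hstep : ‖a (n + 1)‖ ^ 2 ≤ (1 - ‖a 0‖ ^ 2) ^ 2 -
        (1 - ‖a 0‖ ^ 2) * ∑ k ∈ Finset.range n, ‖a (k + 1)‖ ^ 2 := by
      rcases ha0.lt_or_eq with hlt | heq
      · have hpos : 0 < 1 - ‖a 0‖ ^ 2 := by linarith
        set t : ℝ := 1 - ‖a 0‖ ^ 2 with ht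
        have key := aux_one f hb a ha (n + 1) (by omega)
          (starRingEnd ℂ (a 0) * a (n + 1) * ((1 / t : ℝ) : ℂ))
        rw [Finset.sum_range_succ'] at key
        have hm : a 0 * starRingEnd ℂ (a 0) = ((1 - t : ℝ) : ℂ) := by
          rw [Complex.mul_conj, Complex.normSq_eq_norm_sq, ht]; congr 1; ring
        have e : a (n + 1) + a 0 * (starRingEnd ℂ (a 0) * a (n + 1) * ((1 / t : ℝ) : ℂ)) =
            a (n + 1) * ((1 / t : ℝ) : ℂ) := by
          have : a 0 * (starRingEnd ℂ (a 0) * a (n + 1) * ((1 / t : ℝ) : ℂ)) =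
            (a 0 * starRingEnd ℂ (a 0)) * (a (n + 1) * ((1 / t : ℝ) : ℂ)) := by ring
          rw [this, hm]
          have ht0 : (t : ℂ) ≠ 0 := by exact_mod_cast hpos.ne'
          push_cast
          field_simp
          ring
        rw [e] at key
        simp only [norm_mul, mul_pow, RCLike.norm_conj, Complex.norm_real, Real.norm_eq_abs,
          sq_abs] at key
        have e3 : ‖a 0‖ ^ 2 = 1 - t := by rw [ht]; ring
        rw [e3] at key
        have : ‖a (n + 1)‖ ^ 2 * (1 / t) ^ 2 * t = ‖a (n + 1)‖ ^ 2 / t := by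
          field_simp
        have h4 : ‖a (n + 1)‖ ^ 2 / t ≤ t - ∑ k ∈ Finset.range n, ‖a (k + 1)‖ ^ 2 := by
          linarith
        rw [div_le_iff₀ hpos] at h4
        linarith
      · have key := aux_one f hb a ha (n + 1) (by omega) 0
        rw [Finset.sum_range_succ'] at key
        simp [heq] at key
        rw [heq]
        have : 0 ≤ ∑ k ∈ Finset.range n, ‖a (k + 1)‖ ^ 2 :=
          Finset.sum_nonneg fun _ _ => by positivity
        nlinarith
    rw [Finset.sum_range_succ, Finset.sum_range_succ']
    have e5 : ∑ k ∈ Finset.range n, (1 - ‖a 0‖ ^ 2) ^ 2 * (‖a 0‖ ^ 2) ^ (k + 1) =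
        ‖a 0‖ ^ 2 * ∑ k ∈ Finset.range n, (1 - ‖a 0‖ ^ 2) ^ 2 * (‖a 0‖ ^ 2) ^ k := by
      rw [Finset.mul_sum]
      exact Finset.sum_congr rfl fun k _ => by ring
    rw [e5]
    have := mul_le_mul_of_nonneg_left ih (sq_nonneg ‖a 0‖)
    linarith

lemma aux_abel (w d : ℕ → ℝ) (hw : Antitone w) 
    (hd : ∀ n, 0 ≤ ∑ k ∈ Finset.range n, d k) (n : ℕ) :
    w n * ∑ k ∈ Finset.range n, d k ≤ ∑ k ∈ Finset.range n, w k * d k := by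
  induction n with
  | zero => simp
  | succ n ih =>
    have h1 := mul_le_mul_of_nonneg_right (hw (Nat.le_succ n)) (hd (n + 1))
    rw [Finset.sum_range_succ (fun k => w k * d k)]
    refine h1.trans ?_
    rw [Finset.sum_range_succ]
    linarith

/-- For `f ∈ 𝓑` with Taylor coefficients `aₙ` and `0 < r ≤ 1/√2`:
`S_r(f)/π ≤ r²(1−|a₀|²)²/(1−|a₀|²r²)²`, and consequently
`S_r(f)/(π − S_r(f)) ≤ r²(1−|a₀|²)²/((1−r²)(1−r²|a₀|⁴))`. -/
theorem Sarea_bound (f : ℂ → ℂ)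
    (hd : DifferentiableOn ℂ f (ball (0 : ℂ) 1))
    (hb : ∀ z ∈ ball (0 : ℂ) 1, ‖f z‖ ≤ 1)
    (a : ℕ → ℂ)
    (ha : ∀ z ∈ ball (0 : ℂ) 1, HasSum (fun n : ℕ => a n * z ^ n) (f z))
    (r : ℝ) (hr0 : 0 < r) (hr : r ≤ 1 / Real.sqrt 2) :
    Sarea a r / Real.pi ≤
      r ^ 2 * (1 - ‖a 0‖ ^ 2) ^ 2 / (1 - ‖a 0‖ ^ 2 * r ^ 2) ^ 2 ∧
    Sarea a r / (Real.pi - Sarea a r) ≤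
      r ^ 2 * (1 - ‖a 0‖ ^ 2) ^ 2 / ((1 - r ^ 2) * (1 - r ^ 2 * ‖a 0‖ ^ 4)) := by
  have hr2 : r ^ 2 ≤ 1 / 2 := by
    have := pow_le_pow_left₀ hr0.le hr 2
    simpa using this
  have hr2pos : 0 < r ^ 2 := by positivity
  have ha0 : ‖a 0‖ ^ 2 ≤ 1 := by
    have := aux_one f hb a ha 1 le_rfl 0
    simp at this
    nlinarith [sq_nonneg ‖a 1‖]
  have hrog := aux_rog f hb a ha
  have hA : 0 ≤ ‖a 0‖ ^ 2 := by positivity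
  have h4 : ‖a 0‖ ^ 4 = (‖a 0‖ ^ 2) ^ 2 := by ring
  rw [h4]
  generalize hAdef : ‖a 0‖ ^ 2 = A at *
  have hAr : A * r ^ 2 < 1 := by nlinarith
  have hanti : Antitone (fun k : ℕ => ((k : ℝ) + 1) * (r ^ 2) ^ (k + 1)) := by
    apply antitone_nat_of_succ_le
    intro k
    have hk : (0 : ℝ) ≤ k := Nat.cast_nonneg k
    have : (((k + 1 : ℕ) : ℝ) + 1) * (r ^ 2) ≤ (k : ℝ) + 1 := by
      push_cast; nlinarith
    calc (((k + 1 : ℕ) : ℝ) + 1) * (r ^ 2) ^ (k + 1 + 1)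
        = ((((k + 1 : ℕ) : ℝ) + 1) * (r ^ 2)) * (r ^ 2) ^ (k + 1) := by ring
      _ ≤ _ := by gcongr
  have hsum : HasSum (fun k : ℕ => (k : ℝ) * (A * r ^ 2) ^ k)
      (A * r ^ 2 / (1 - A * r ^ 2) ^ 2) := by
    apply hasSum_coe_mul_geometric_of_norm_lt_one
    rw [Real.norm_of_nonneg (by positivity)]
    exact hAr
  have hsum1 : HasSum (fun k : ℕ => (A * r ^ 2) ^ k) (1 - A * r ^ 2)⁻¹ :=
    hasSum_geometric_of_lt_one (by positivity) hAr
  have hB : HasSum (fun k : ℕ => (((k : ℝ) + 1) * (r ^ 2) ^ (k + 1)) * ((1 - A) ^ 2 * A ^ k))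
      (r ^ 2 * (1 - A) ^ 2 / (1 - A * r ^ 2) ^ 2) := by
    have h := (hsum.add hsum1).mul_left (r ^ 2 * (1 - A) ^ 2)
    have e1 : (fun k : ℕ => (((k : ℝ) + 1) * (r ^ 2) ^ (k + 1)) * ((1 - A) ^ 2 * A ^ k)) =
        fun k : ℕ => r ^ 2 * (1 - A) ^ 2 * ((k : ℝ) * (A * r ^ 2) ^ k + (A * r ^ 2) ^ k) := by
      funext k; rw [mul_pow]; ring
    have e2 : r ^ 2 * (1 - A) ^ 2 / (1 - A * r ^ 2) ^ 2 =
        r ^ 2 * (1 - A) ^ 2 * (A * r ^ 2 / (1 - A * r ^ 2) ^ 2 + (1 - A * r ^ 2)⁻¹) := by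
      have : 1 - A * r ^ 2 ≠ 0 := by linarith
      field_simp
      ring
    rw [e1, e2]
    exact h
  have hS : Sarea a r / Real.pi = ∑' n : ℕ, (n : ℝ) * ‖a n‖ ^ 2 * r ^ (2 * n) := by
    rw [Sarea, mul_div_cancel_left₀ _ Real.pi_ne_zero]
  have hbound : ∑' n : ℕ, (n : ℝ) * ‖a n‖ ^ 2 * r ^ (2 * n) ≤
      r ^ 2 * (1 - A) ^ 2 / (1 - A * r ^ 2) ^ 2 := by
    apply Real.tsum_le_of_sum_range_le
    · intro n; positivity
    intro n
    rcases n with _ | n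
    · simp; positivity
    rw [Finset.sum_range_succ']
    have habel := aux_abel _ (fun k => (1 - A) ^ 2 * A ^ k - ‖a (k + 1)‖ ^ 2) hanti
      (fun n => by rw [Finset.sum_sub_distrib]; linarith [hrog n]) n
    have h0 : 0 ≤ (((n : ℝ) + 1) * (r ^ 2) ^ (n + 1)) *
        ∑ k ∈ Finset.range n, ((1 - A) ^ 2 * A ^ k - ‖a (k + 1)‖ ^ 2) := by
      apply mul_nonneg (by positivity)
      rw [Finset.sum_sub_distrib]; linarith [hrog n]
    have h1 := h0.trans habel
    simp only [mul_sub, Finset.sum_sub_distrib] at h1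
    have h2 := sum_le_hasSum (Finset.range n) (fun k _ => by positivity) hB
    have h3 : ∑ k ∈ Finset.range n, ((k + 1 : ℕ) : ℝ) * ‖a (k + 1)‖ ^ 2 * r ^ (2 * (k + 1)) =
        ∑ k ∈ Finset.range n, (((k : ℝ) + 1) * (r ^ 2) ^ (k + 1)) * ‖a (k + 1)‖ ^ 2 := by
      apply Finset.sum_congr rfl
      intro k _
      rw [pow_mul]; push_cast; ring
    rw [h3]
    simp only [Nat.cast_zero, zero_mul, add_zero]
    linarith
  refine ⟨by rw [hS]; exact hbound, ?_⟩
  have hSm : Sarea a r = Real.pi * (∑' n : ℕ, (n : ℝ) * ‖a n‖ ^ 2 * r ^ (2 * n)) := rfl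
  rw [hSm]
  generalize (∑' n : ℕ, (n : ℝ) * ‖a n‖ ^ 2 * r ^ (2 * n)) = s at hbound
  have hD : 0 < (1 - A * r ^ 2) ^ 2 := by
    have : 0 < 1 - A * r ^ 2 := by linarith
    positivity
  have hE : 0 < (1 - r ^ 2) * (1 - r ^ 2 * A ^ 2) := by
    apply mul_pos <;> nlinarith
  have hid : (1 - A * r ^ 2) ^ 2 - r ^ 2 * (1 - A) ^ 2 = (1 - r ^ 2) * (1 - r ^ 2 * A ^ 2) := by
    ring
  rw [le_div_iff₀ hD] at hbound
  have hs1 : 0 < 1 - s := by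
    by_contra hcon
    nlinarith
  rw [show Real.pi - Real.pi * s = Real.pi * (1 - s) by ring,
    mul_div_mul_left _ _ Real.pi_ne_zero, div_le_div_iff₀ hs1 hE, ← hid]
  linarith
end

section
/- For every f ∈ 𝓑 and every 0 ≤ r ≤ 1/3, one has (16/9)·S_r(f)/(π − S_r(f)) ≤ ψ(f,r), i.e. the extra term in the strengthened Bohr inequality given by ψ dominates the extra term (16/9)·S_r/(π − S_r) of Kayumov–Ponnusamy. -/
open Metric

/-- `Ψ(a,r) = 1 − a − r(1−a²)/(1−ar)` if `r ≤ a`, and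
`Ψ(a,r) = 1 − a − r√(1−a²)/√(1−r²)` if `a < r`. -/
noncomputable def Psi (a r : ℝ) : ℝ :=
  if r ≤ a then 1 - a - r * (1 - a ^ 2) / (1 - a * r)
  else 1 - a - r * Real.sqrt (1 - a ^ 2) / Real.sqrt (1 - r ^ 2)

open Complex MeasureTheory intervalIntegral in
lemma exp_int (m : ℤ) : ∫ θ in (0:ℝ)..(2 * Real.pi), Complex.exp ((m * Complex.I) * θ) =
    if m = 0 then (2 * Real.pi : ℂ) else 0 := by
  split_ifs with h
  · subst h; simp
  · have hc : (m * Complex.I : ℂ) ≠ 0 := by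
      simp [h]
    rw [integral_exp_mul_complex hc]
    have : Complex.exp ((m * Complex.I) * ((2 * Real.pi : ℝ) : ℂ)) = 1 := by
      rw [Complex.exp_eq_one_iff]
      exact ⟨m, by push_cast; ring⟩
    rw [this]; simp

lemma norm_exp_aux (m : ℤ) (θ : ℝ) : ‖Complex.exp ((m * Complex.I) * θ)‖ = 1 := by
  have : (m * Complex.I : ℂ) * θ = ((m * θ : ℝ) : ℂ) * Complex.I := by push_cast; ring
  rw [this, Complex.norm_exp_ofReal_mul_I]

lemma hasSum_of_eq {g h : ℕ → ℂ} {s : ℂ} (hg : HasSum g s) (e : ∀ k, h k = g k) :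
    HasSum h s := by
  have : h = g := funext e
  rw [this]; exact hg

lemma coef_int (f : ℂ → ℂ) (a : ℕ → ℂ)
    (ha : ∀ z ∈ ball (0 : ℂ) 1, HasSum (fun n : ℕ => a n * z ^ n) (f z))
    (ρ : ℝ) (h0 : 0 ≤ ρ) (h1 : ρ < 1) (m : ℤ) :
    HasSum (fun k : ℕ => a k * ρ ^ k * (if (k : ℤ) + m = 0 then (2 * Real.pi : ℂ) else 0))
      (∫ θ in (0:ℝ)..(2 * Real.pi),
        f (ρ * Complex.exp (Complex.I * θ)) * Complex.exp ((m * Complex.I) * θ)) := by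
  have hs : Summable (fun k : ℕ => ‖a k‖ * ρ ^ k) := by
    have := (ha ρ (by simp [abs_of_nonneg h0, h1])).summable.norm
    simpa [abs_of_nonneg h0] using this
  have key := intervalIntegral.hasSum_integral_of_dominated_convergence
    (μ := MeasureTheory.volume) (a := 0) (b := 2 * Real.pi)
    (F := fun (k : ℕ) (θ : ℝ) => a k * ρ ^ k * Complex.exp ((((k : ℤ) + m : ℤ) * Complex.I) * θ))
    (f := fun θ : ℝ => f (ρ * Complex.exp (Complex.I * θ)) * Complex.exp ((m * Complex.I) * θ))
    (fun k _ => ‖a k‖ * ρ ^ k)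
    (fun k => by
      apply Continuous.aestronglyMeasurable
      fun_prop)
    (fun k => by
      filter_upwards with θ _
      rw [norm_mul, norm_exp_aux]
      simp [abs_of_nonneg h0])
    (by filter_upwards with θ _; exact hs)
    (by simp)
    (by
      filter_upwards with θ _
      have hz : (ρ * Complex.exp (Complex.I * θ) : ℂ) ∈ ball (0 : ℂ) 1 := by
        have := norm_exp_aux 1 θ
        simp only [Int.cast_one, one_mul] at this
        simp [this, abs_of_nonneg h0, h1]
      have := (ha _ hz).mul_right (Complex.exp ((m * Complex.I) * θ))
      refine hasSum_of_eq this (fun k => ?_)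
      rw [mul_pow, ← Complex.exp_nat_mul]
      push_cast
      have hx : ((k : ℂ) + m) * Complex.I * θ = k * (Complex.I * θ) + m * Complex.I * θ := by ring
      rw [hx, Complex.exp_add]
      ring)
  refine hasSum_of_eq key (fun k => ?_)
  rw [intervalIntegral.integral_const_mul, exp_int]

lemma coef_int_nonpos (f : ℂ → ℂ) (a : ℕ → ℂ)
    (ha : ∀ z ∈ ball (0 : ℂ) 1, HasSum (fun n : ℕ => a n * z ^ n) (f z))
    (ρ : ℝ) (h0 : 0 ≤ ρ) (h1 : ρ < 1) (n : ℕ) :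
    (∫ θ in (0:ℝ)..(2 * Real.pi),
        f (ρ * Complex.exp (Complex.I * θ)) * Complex.exp ((((-n : ℤ) : ℂ) * Complex.I) * θ))
      = a n * ρ ^ n * (2 * Real.pi) := by
  have h := coef_int f a ha ρ h0 h1 (-n)
  have h2 := hasSum_single (f := fun k : ℕ => a k * ρ ^ k *
    (if (k : ℤ) + (-n : ℤ) = 0 then (2 * Real.pi : ℂ) else 0)) n (by
      intro k hk
      have : ¬ ((k : ℤ) + (-n : ℤ) = 0) := by omega
      simp only [if_neg this, mul_zero])
  simpa using h.unique h2

lemma coef_int_pos (f : ℂ → ℂ) (a : ℕ → ℂ)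
    (ha : ∀ z ∈ ball (0 : ℂ) 1, HasSum (fun n : ℕ => a n * z ^ n) (f z))
    (ρ : ℝ) (h0 : 0 ≤ ρ) (h1 : ρ < 1) (n : ℕ) (hn : n ≠ 0) :
    (∫ θ in (0:ℝ)..(2 * Real.pi),
        f (ρ * Complex.exp (Complex.I * θ)) * Complex.exp ((((n : ℤ) : ℂ) * Complex.I) * θ))
      = 0 := by
  have h := coef_int f a ha ρ h0 h1 n
  have h2 : HasSum (fun k : ℕ => a k * ρ ^ k *
    (if (k : ℤ) + (n : ℤ) = 0 then (2 * Real.pi : ℂ) else 0)) 0 := by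
    convert hasSum_zero using 2 with k
    have : ¬ ((k : ℤ) + (n : ℤ) = 0) := by omega
    simp only [if_neg this, mul_zero]
  exact h.unique h2

/-- Pointwise kernel inequality. -/
lemma kernel_ineq (b w e ei F : ℂ) (hw : ‖w‖ = 1) (he : ‖e‖ = 1) (hee : ei * e = 1)
    (hF : ‖F‖ ≤ 1) :
    0 ≤ (((1 + ‖b‖ ^ 2 : ℝ) : ℂ) + 2 * (starRingEnd ℂ b * starRingEnd ℂ w * e)
      - (2 * starRingEnd ℂ b * F + w * (F * ei)
        + starRingEnd ℂ b ^ 2 * starRingEnd ℂ w * (F * e))).re := by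
  set c := starRingEnd ℂ b with hc
  set v := starRingEnd ℂ w with hv
  have hwv : w * v = 1 := by rw [hv, Complex.mul_conj, Complex.normSq_eq_norm_sq, hw]; simp
  have hu : ‖v * e‖ = 1 := by rw [norm_mul, hv, Complex.norm_conj, hw, he, one_mul]
  have hq : 2 * c * F + w * (F * ei) + c ^ 2 * v * (F * e)
      = F * (w * ei) * ((1 + c * (v * e)) ^ 2) := by
    have h1 : (w * ei) * (v * e) = 1 := by
      calc (w * ei) * (v * e) = (w * v) * (ei * e) := by ring
        _ = 1 := by rw [hwv, hee, one_mul]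
    linear_combination (-2 * c * F - c ^ 2 * F * (v * e)) * h1
  have hwe : ‖w * ei‖ = 1 := by
    have : ‖ei * e‖ = 1 := by rw [hee]; simp
    rw [norm_mul, he, mul_one] at this
    rw [norm_mul, hw, this, one_mul]
  have hsq : ‖1 + c * (v * e)‖ ^ 2 = 1 + ‖b‖ ^ 2 + 2 * (c * v * e).re := by
    rw [← Complex.normSq_eq_norm_sq, Complex.normSq_add, Complex.normSq_eq_norm_sq (c * (v * e)),
      norm_mul, hu, hc, Complex.norm_conj]
    simp only [map_one, one_mul, mul_one, Complex.conj_re, mul_assoc]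
  have hn : ‖F * (w * ei) * ((1 + c * (v * e)) ^ 2)‖ ≤ 1 + ‖b‖ ^ 2 + 2 * (c * v * e).re := by
    rw [norm_mul, norm_mul, hwe, mul_one, norm_pow, ← hsq]
    exact mul_le_of_le_one_left (by positivity) hF
  have := (Complex.re_le_norm _).trans hn
  rw [hq, Complex.sub_re, Complex.add_re, Complex.ofReal_re]
  have h2 : (2 * (c * v * e)).re = 2 * (c * v * e).re := by simp
  linarith

lemma coef_bound_rho (f : ℂ → ℂ)
    (hd : DifferentiableOn ℂ f (ball (0 : ℂ) 1))
    (hb : ∀ z ∈ ball (0 : ℂ) 1, ‖f z‖ ≤ 1)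
    (a : ℕ → ℂ)
    (ha : ∀ z ∈ ball (0 : ℂ) 1, HasSum (fun n : ℕ => a n * z ^ n) (f z))
    (ρ : ℝ) (h0 : 0 ≤ ρ) (h1 : ρ < 1) (n : ℕ) (hn : n ≠ 0) (hne : a n ≠ 0) :
    ‖a n‖ * ρ ^ n ≤ 1 - ‖a 0‖ ^ 2 := by
  obtain ⟨w, hw, hwa⟩ : ∃ w : ℂ, ‖w‖ = 1 ∧ w * a n = ‖a n‖ := by
    refine ⟨‖a n‖ / a n, ?_, ?_⟩
    · simp [hne]
    · field_simp
  set c := starRingEnd ℂ (a 0) with hc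
  set v := starRingEnd ℂ w with hv
  let F : ℝ → ℂ := fun θ => f (ρ * Complex.exp (Complex.I * θ))
  let e : ℤ → ℝ → ℂ := fun m θ => Complex.exp (((m : ℂ) * Complex.I) * θ)
  have hz : ∀ θ : ℝ, (ρ * Complex.exp (Complex.I * θ) : ℂ) ∈ ball (0 : ℂ) 1 := by
    intro θ
    have := norm_exp_aux 1 θ
    simp only [Int.cast_one, one_mul] at this
    simp [this, abs_of_nonneg h0, h1]
  have hFc : Continuous F := by
    refine hd.continuousOn.comp_continuous (by fun_prop) hz
  have hec : ∀ m, Continuous (e m) := fun m => by fun_prop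
  have hecn := hec n
  have hecm := hec (-n)
  have I0 : ∫ θ in (0:ℝ)..(2 * Real.pi), F θ = a 0 * (2 * Real.pi) := by
    have := coef_int_nonpos f a ha ρ h0 h1 0
    simpa [F] using this
  have I1 : ∫ θ in (0:ℝ)..(2 * Real.pi), F θ * e (-n) θ = a n * ρ ^ n * (2 * Real.pi) :=
    coef_int_nonpos f a ha ρ h0 h1 n
  have I2 : ∫ θ in (0:ℝ)..(2 * Real.pi), F θ * e n θ = 0 :=
    coef_int_pos f a ha ρ h0 h1 n hn
  have I3 : ∫ θ in (0:ℝ)..(2 * Real.pi), e n θ = 0 := by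
    have := exp_int n
    rw [if_neg (by exact_mod_cast hn)] at this
    exact this
  let G : ℝ → ℂ := fun θ => ((1 + ‖a 0‖ ^ 2 : ℝ) : ℂ) + 2 * (c * v * e n θ)
      - (2 * c * F θ + w * (F θ * e (-n) θ) + c ^ 2 * v * (F θ * e n θ))
  have hGc : Continuous G := by fun_prop
  have hG : ∫ θ in (0:ℝ)..(2 * Real.pi), G θ
      = (((2 * Real.pi) * (1 - ‖a 0‖ ^ 2 - ‖a n‖ * ρ ^ n) : ℝ) : ℂ) := by
    have ii : ∀ g : ℝ → ℂ, Continuous g →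
      IntervalIntegrable g MeasureTheory.volume 0 (2 * Real.pi) := fun g hg =>
        hg.intervalIntegrable _ _
    simp only [G]
    rw [intervalIntegral.integral_sub (ii _ (by fun_prop)) (ii _ (by fun_prop)),
      intervalIntegral.integral_add (ii _ (by fun_prop)) (ii _ (by fun_prop)),
      intervalIntegral.integral_add (ii _ (by fun_prop)) (ii _ (by fun_prop)),
      intervalIntegral.integral_add (ii _ (by fun_prop)) (ii _ (by fun_prop)),
      intervalIntegral.integral_const, intervalIntegral.integral_const_mul,
      intervalIntegral.integral_const_mul, intervalIntegral.integral_const_mul,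
      intervalIntegral.integral_const_mul, intervalIntegral.integral_const_mul, I0, I1, I2, I3]
    have hca : c * a 0 = (‖a 0‖ : ℂ) ^ 2 := by
      rw [hc, mul_comm, Complex.mul_conj, Complex.normSq_eq_norm_sq]; push_cast; rfl
    simp only [Complex.real_smul]
    push_cast
    linear_combination (-2 * (2 * Real.pi : ℂ)) * hca - (ρ ^ n * (2 * Real.pi : ℂ)) * hwa
  have hre : ∫ θ in (0:ℝ)..(2 * Real.pi), (G θ).re
      = (2 * Real.pi) * (1 - ‖a 0‖ ^ 2 - ‖a n‖ * ρ ^ n) := by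
    have := Complex.reCLM.intervalIntegral_comp_comm (hGc.intervalIntegrable
      (μ := MeasureTheory.volume) 0 (2 * Real.pi))
    simp only [Complex.reCLM_apply] at this
    rw [this, hG, Complex.ofReal_re]
  have hpos : 0 ≤ ∫ θ in (0:ℝ)..(2 * Real.pi), (G θ).re := by
    apply intervalIntegral.integral_nonneg (by positivity)
    intro θ _
    apply kernel_ineq (a 0) w (e n θ) (e (-n) θ) (F θ) hw (norm_exp_aux n θ) ?_ (hb _ (hz θ))
    simp only [e]
    rw [← Complex.exp_add]
    convert Complex.exp_zero using 2
    push_cast; ring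
  rw [hre] at hpos
  have := nonneg_of_mul_nonneg_right hpos (by positivity)
  linarith

lemma coef_zero (f : ℂ → ℂ) (a : ℕ → ℂ)
    (ha : ∀ z ∈ ball (0 : ℂ) 1, HasSum (fun n : ℕ => a n * z ^ n) (f z)) : f 0 = a 0 := by
  have h := ha 0 (by simp)
  have h2 := hasSum_single (f := fun n : ℕ => a n * (0:ℂ) ^ n) 0 (by
    intro k hk; simp [hk])
  simpa using h.unique h2

lemma coef_bound (f : ℂ → ℂ)
    (hd : DifferentiableOn ℂ f (ball (0 : ℂ) 1))
    (hb : ∀ z ∈ ball (0 : ℂ) 1, ‖f z‖ ≤ 1)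
    (a : ℕ → ℂ)
    (ha : ∀ z ∈ ball (0 : ℂ) 1, HasSum (fun n : ℕ => a n * z ^ n) (f z))
    (n : ℕ) (hn : n ≠ 0) : ‖a n‖ ≤ 1 - ‖f 0‖ ^ 2 := by
  have hf0 := hb 0 (by simp)
  by_cases hne : a n = 0
  · rw [hne, norm_zero]
    nlinarith [norm_nonneg (f 0)]
  rw [coef_zero f a ha]
  have ht : Filter.Tendsto (fun ρ : ℝ => ‖a n‖ * ρ ^ n) (nhdsWithin 1 (Set.Iio 1))
      (nhds (‖a n‖ * 1 ^ n)) := by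
    apply Filter.Tendsto.mono_left _ nhdsWithin_le_nhds
    exact (Continuous.tendsto (by fun_prop) 1)
  rw [one_pow, mul_one] at ht
  apply le_of_tendsto ht
  filter_upwards [Ico_mem_nhdsLT (show (0:ℝ) < 1 by norm_num)] with ρ hρ
  exact coef_bound_rho f hd hb a ha ρ hρ.1 hρ.2 n hn hne

lemma area_bound (a : ℕ → ℂ) (B r : ℝ) (hr0 : 0 ≤ r) (hr : r ≤ 1 / 3)
    (h : ∀ n, n ≠ 0 → ‖a n‖ ≤ B) :
    0 ≤ ∑' n : ℕ, (n : ℝ) * ‖a n‖ ^ 2 * r ^ (2 * n) ∧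
    ∑' n : ℕ, (n : ℝ) * ‖a n‖ ^ 2 * r ^ (2 * n) ≤ 9 / 64 * B ^ 2 := by
  refine ⟨tsum_nonneg fun n => by positivity, ?_⟩
  have hq : ‖(1 / 9 : ℝ)‖ < 1 := by norm_num
  have hs := (hasSum_coe_mul_geometric_of_norm_lt_one hq).mul_left (B ^ 2)
  have hle : ∀ n : ℕ, (n : ℝ) * ‖a n‖ ^ 2 * r ^ (2 * n) ≤ B ^ 2 * (n * (1 / 9 : ℝ) ^ n) := by
    intro n
    rcases eq_or_ne n 0 with rfl | hn
    · simp
    have h1 : r ^ (2 * n) ≤ (1 / 9 : ℝ) ^ n := by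
      rw [pow_mul]
      apply pow_le_pow_left₀ (by positivity)
      nlinarith
    have h2 : ‖a n‖ ^ 2 ≤ B ^ 2 := pow_le_pow_left₀ (norm_nonneg _) (h n hn) 2
    calc (n : ℝ) * ‖a n‖ ^ 2 * r ^ (2 * n) ≤ (n : ℝ) * B ^ 2 * (1 / 9 : ℝ) ^ n := by gcongr
      _ = _ := by ring
  have hsum : Summable fun n : ℕ => (n : ℝ) * ‖a n‖ ^ 2 * r ^ (2 * n) :=
    Summable.of_nonneg_of_le (fun n => by positivity) hle hs.summable
  have := hsum.tsum_le_tsum hle hs.summable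
  rw [hs.tsum_eq] at this
  refine this.trans (le_of_eq ?_)
  norm_num
  ring

lemma psi_lower (t r : ℝ) (ht0 : 0 ≤ t) (ht : t ≤ 1) (hr0 : 0 ≤ r) (hr : r ≤ 1 / 3) :
    16 * (1 - t ^ 2) ^ 2 / (64 - 9 * (1 - t ^ 2) ^ 2) ≤ Psi t r := by
  have hu1 : (1 - t ^ 2) ^ 2 ≤ 1 := by
    apply pow_le_one₀ <;> nlinarith
  have hden : 0 < 64 - 9 * (1 - t ^ 2) ^ 2 := by linarith
  unfold Psi
  split_ifs with h
  · have h1 : 16 * (1 - t ^ 2) ^ 2 / (64 - 9 * (1 - t ^ 2) ^ 2) ≤ 2 * (1 - t) ^ 2 / (3 - t) := by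
      rw [div_le_div_iff₀ hden (by linarith)]
      have : 8 * (1 + t) ^ 2 * (3 - t) ≤ 64 - 9 * (1 - t ^ 2) ^ 2 := by
        have h3 : 64 - 9 * (1 - t ^ 2) ^ 2 - 8 * (1 + t) ^ 2 * (3 - t)
          = (1 - t) * (31 - 9 * t + t ^ 2 + 9 * t ^ 3) := by ring
        have h4 : 0 ≤ (1 - t) * (31 - 9 * t + t ^ 2 + 9 * t ^ 3) :=
          mul_nonneg (by linarith) (by nlinarith [pow_nonneg ht0 3, sq_nonneg t])
        linarith
      calc 16 * (1 - t ^ 2) ^ 2 * (3 - t)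
          = 2 * (1 - t) ^ 2 * (8 * (1 + t) ^ 2 * (3 - t)) := by ring
        _ ≤ _ := by gcongr
    have h2 : r * (1 - t ^ 2) / (1 - t * r) ≤ (1 - t ^ 2) / (3 - t) := by
      have htr : 0 < 1 - t * r := by nlinarith
      rw [div_le_div_iff₀ htr (by linarith)]
      have : 0 ≤ (1 - t ^ 2) * (1 - 3 * r) := mul_nonneg (by nlinarith) (by linarith)
      linarith
    have h3 : 2 * (1 - t) ^ 2 / (3 - t) = 1 - t - (1 - t ^ 2) / (3 - t) := by
      have : 3 - t ≠ 0 := by linarith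
      field_simp
      ring
    linarith
  · push Not at h
    have h1 : 16 * (1 - t ^ 2) ^ 2 / (64 - 9 * (1 - t ^ 2) ^ 2) ≤ 16 / 55 := by
      rw [div_le_div_iff₀ hden (by norm_num)]
      linarith
    have h2 : Real.sqrt (1 - t ^ 2) ≤ 1 := by
      rw [Real.sqrt_le_iff]; constructor <;> nlinarith
    have h3 : (14 / 15 : ℝ) ≤ Real.sqrt (1 - r ^ 2) := by
      apply Real.le_sqrt_of_sq_le; nlinarith
    have h4 : r * Real.sqrt (1 - t ^ 2) / Real.sqrt (1 - r ^ 2) ≤ (1 / 3) * 1 / (14 / 15) := by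
      gcongr
    norm_num at h4
    linarith

/-- For every `f ∈ 𝓑` and `0 ≤ r ≤ 1/3`, the extra term `ψ(f,r) = Ψ(|f(0)|,r)`
dominates the Kayumov–Ponnusamy extra term: `(16/9) S_r/(π − S_r) ≤ ψ(f,r)`. -/
theorem psi_dominates_area_term (f : ℂ → ℂ)
    (hd : DifferentiableOn ℂ f (ball (0 : ℂ) 1))
    (hb : ∀ z ∈ ball (0 : ℂ) 1, ‖f z‖ ≤ 1)
    (a : ℕ → ℂ)
    (ha : ∀ z ∈ ball (0 : ℂ) 1, HasSum (fun n : ℕ => a n * z ^ n) (f z))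
    (r : ℝ) (hr0 : 0 ≤ r) (hr : r ≤ 1 / 3) :
    16 / 9 * (Sarea a r / (Real.pi - Sarea a r)) ≤ Psi ‖f 0‖ r := by
  have hf0 := hb 0 (by simp)
  set t := ‖f 0‖ with ht
  have ht0 : 0 ≤ t := norm_nonneg _
  obtain ⟨hx0, hx1⟩ := area_bound a (1 - t ^ 2) r hr0 hr (coef_bound f hd hb a ha)
  refine le_trans ?_ (psi_lower t r ht0 hf0 hr0 hr)
  unfold Sarea
  set x := ∑' n : ℕ, (n : ℝ) * ‖a n‖ ^ 2 * r ^ (2 * n) with hx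
  have hu1 : (1 - t ^ 2) ^ 2 ≤ 1 := by
    apply pow_le_one₀ <;> nlinarith
  have hden : 0 < 64 - 9 * (1 - t ^ 2) ^ 2 := by linarith
  have hx2 : 0 < 1 - x := by linarith
  have e1 : Real.pi * x / (Real.pi - Real.pi * x) = x / (1 - x) := by
    rw [show Real.pi - Real.pi * x = Real.pi * (1 - x) by ring,
      mul_div_mul_left _ _ Real.pi_ne_zero]
  rw [e1, ← mul_div_assoc, div_le_div_iff₀ hx2 hden]
  nlinarith
end
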